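/- arXiv:2407.00058 — 6 statements merged into one kernel-verified Lean document; each statement's English description precedes it below -/
import Mathlib

section
/- For all n ≥ 0, the number of partitions of 5n+4 is divisible by 5. -/
open Finset PowerSeries

/-- A power series all of whose exponents reduce to `r` modulo `m`. -/
def PowerSeries.SupportedOnResidue {R : Type*} [Semiring R] (m : ℕ) (r : ZMod m) (f : R⟦X⟧) :
    Prop :=
  ∀ n : ℕ, (n : ZMod m) ≠ r → coeff n f = 0

namespace PowerSeries.SupportedOnResidue

variable {R : Type*} {m : ℕ} {r s : ZMod m}

theorem add [Semiring R] {f g : R⟦X⟧} (hf : SupportedOnResidue m r f)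
    (hg : SupportedOnResidue m r g) : SupportedOnResidue m r (f + g) := fun n hn ↦ by
  rw [map_add, hf n hn, hg n hn, add_zero]

theorem mul [Semiring R] {f g : R⟦X⟧} (hf : SupportedOnResidue m r f)
    (hg : SupportedOnResidue m s g) : SupportedOnResidue m (r + s) (f * g) := fun n hn ↦ by
  rw [coeff_mul]
  refine sum_eq_zero fun p hp ↦ ?_
  by_cases h₁ : (p.1 : ZMod m) = r
  · have h₂ : (p.2 : ZMod m) ≠ s := by
      rintro rfl
      rw [← mem_antidiagonal.mp hp, ← h₁, Nat.cast_add] at hn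
      exact hn rfl
    rw [hg _ h₂, mul_zero]
  · rw [hf _ h₁, zero_mul]

end PowerSeries.SupportedOnResidue

/-- In characteristic `p`, the `p`-th power of a power series only has exponents divisible
by `p`. -/
theorem PowerSeries.supportedOnResidue_pow_char {R : Type*} [CommRing R] (p : ℕ) [Fact p.Prime]
    [CharP R p] (f : R⟦X⟧) : SupportedOnResidue p 0 (f ^ p) := fun n hn ↦ by
  have hp : p ≠ 0 := (Fact.out : p.Prime).ne_zero
  have := ExpChar.prime (R := R) (Fact.out : p.Prime)
  have h : (f.expand p hp).map (frobenius R p) = f ^ p := MvPowerSeries.map_frobenius_expand p hp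
  rw [← h, coeff_map, coeff_expand_of_not_dvd, map_zero]
  rwa [← ZMod.natCast_eq_zero_iff]

open scoped PowerSeries.WithPiTopology in
/-- The generating function of the partition numbers is inverse to the pentagonal series. -/
theorem Nat.Partition.mk_card_mul_pentagonalSeries (R : Type*) [CommRing R] :
    (PowerSeries.mk fun n ↦ (Fintype.card (Nat.Partition n) : R)) * pentagonalSeries R = 1 := by
  let _ : TopologicalSpace R := ⊥
  have _ : DiscreteTopology R := ⟨rfl⟩
  have h := (hasProd_powerSeriesMk_card_restricted R fun _ ↦ True).mul
    (WithPiTopology.hasProd_one_sub_X_pow R)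
  have hc (n : ℕ) : #(restricted n fun _ ↦ True) = Fintype.card (Nat.Partition n) := by
    simp [restricted]
  simp_rw [hc, if_true, pow_mul] at h
  conv at h in fun b ↦ _ =>
    ext b
    rw [WithPiTopology.tsum_pow_mul_one_sub_of_constantCoeff_eq_zero (by simp)]
  exact h.unique hasProd_one

theorem pentagonal_abs_le (k : ℤ) : |k| ≤ pentagonal k := by
  have := two_mul_natCast_pentagonal k
  rcases abs_cases k with ⟨h, _⟩ | ⟨h, _⟩ <;> rw [h]
  · rcases (by omega : k = 0 ∨ 1 ≤ k) with rfl | _ <;> nlinarith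
  · nlinarith

theorem mem_Icc_of_pentagonal_le {k : ℤ} {n : ℕ} (h : pentagonal k ≤ n) :
    k ∈ Icc (-n : ℤ) n := by
  rw [mem_Icc, ← abs_le]
  exact (pentagonal_abs_le k).trans (mod_cast h)

/-- The terms of the pentagonal series whose index is `r` modulo `m`. -/
noncomputable def pentagonalPart (R : Type*) [CommRing R] (m : ℕ) (r : ZMod m) : R⟦X⟧ :=
  PowerSeries.mk fun n ↦ ∑ k ∈ Icc (-n : ℤ) n with pentagonal k = n ∧ (k : ZMod m) = r,
    ((Int.negOnePow k : ℤ) : R)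

section

variable (R : Type*) [CommRing R]

theorem coeff_pentagonalPart (m : ℕ) (r : ZMod m) {n N : ℕ} (h : n ≤ N) :
    coeff n (pentagonalPart R m r) =
      ∑ k ∈ Icc (-N : ℤ) N with pentagonal k = n ∧ (k : ZMod m) = r,
        ((Int.negOnePow k : ℤ) : R) := by
  rw [pentagonalPart, coeff_mk]
  congr 1
  ext k
  simp only [mem_filter, and_congr_left_iff]
  rintro ⟨hk, -⟩
  exact iff_of_true (mem_Icc_of_pentagonal_le hk.le) (mem_Icc_of_pentagonal_le (hk.le.trans h))

theorem sum_pentagonalPart (m : ℕ) [NeZero m] :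
    ∑ r, pentagonalPart R m r = pentagonalSeries R := by
  ext n
  simp_rw [map_sum, coeff_pentagonalPart R m _ le_rfl, ← filter_filter]
  rw [sum_fiberwise]
  by_cases hn : n ∈ Set.range pentagonal
  · obtain ⟨k, rfl⟩ := hn
    have : {x ∈ Icc (-(pentagonal k) : ℤ) (pentagonal k) | pentagonal x = pentagonal k} = {k} := by
      ext x
      simp only [mem_filter, pentagonal_inj, mem_singleton, and_iff_right_iff_imp]
      rintro rfl
      exact mem_Icc_of_pentagonal_le le_rfl
    rw [this, sum_singleton, coeff_pentagonalSeries_pentagonal]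
  · rw [coeff_pentagonalSeries_eq_zero R hn]
    exact sum_eq_zero fun k hk ↦ absurd ⟨k, (mem_filter.mp hk).2⟩ hn

/-- Pairs of indices whose pentagonal numbers sum to `n`. -/
noncomputable def pentagonalPairs (n : ℕ) : Finset (ℤ × ℤ) :=
  {x ∈ Icc (-n : ℤ) n ×ˢ Icc (-n : ℤ) n | pentagonal x.1 + pentagonal x.2 = n}

theorem mem_pentagonalPairs {n : ℕ} {x : ℤ × ℤ} :
    x ∈ pentagonalPairs n ↔ pentagonal x.1 + pentagonal x.2 = n := by
  simp only [pentagonalPairs, mem_filter, mem_product, and_iff_right_iff_imp]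
  exact fun h ↦ ⟨mem_Icc_of_pentagonal_le (by omega), mem_Icc_of_pentagonal_le (by omega)⟩

theorem coeff_pentagonalPart_mul (m : ℕ) (r s : ZMod m) (n : ℕ) :
    coeff n (pentagonalPart R m r * pentagonalPart R m s) =
      ∑ x ∈ pentagonalPairs n with (x.1 : ZMod m) = r ∧ (x.2 : ZMod m) = s,
        ((Int.negOnePow (x.1 + x.2) : ℤ) : R) := by
  rw [coeff_mul, ← sum_fiberwise_of_maps_to (t := antidiagonal n)
    (g := fun x : ℤ × ℤ ↦ (pentagonal x.1, pentagonal x.2))]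
  · refine sum_congr rfl fun p hp ↦ ?_
    have hp := mem_antidiagonal.mp hp
    rw [coeff_pentagonalPart R m r (by omega : p.1 ≤ n),
      coeff_pentagonalPart R m s (by omega : p.2 ≤ n), sum_mul_sum, ← sum_product']
    refine sum_congr ?_ fun x _ ↦ by simp [Int.negOnePow_add]
    ext x
    simp only [mem_product, mem_filter, mem_pentagonalPairs, Prod.ext_iff]
    constructor
    · grind
    · rintro ⟨⟨hx, hr, hs⟩, h₁, h₂⟩
      exact ⟨⟨mem_Icc_of_pentagonal_le (by omega), h₁, hr⟩,
        mem_Icc_of_pentagonal_le (by omega), h₂, hs⟩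
  · intro x hx
    rw [mem_filter, mem_pentagonalPairs] at hx
    exact mem_antidiagonal.mpr hx.1

/-- The reflection `(x, y) ↦ (-(3x + 4y) / 5, (3y - 4x) / 5)` of the circle `x² + y² = const`,
in the coordinates `x = 6j - 1`, `y = 6k - 1`, is a sign-reversing involution. -/
theorem sum_pentagonalPart_mul_eq_zero :
    ∑ r, pentagonalPart R 5 r * pentagonalPart R 5 (3 * r + 3) = 0 := by
  ext n
  have h (r : ZMod 5) : coeff n (pentagonalPart R 5 r * pentagonalPart R 5 (3 * r + 3)) =
      ∑ x ∈ {x ∈ pentagonalPairs n | (x.2 : ZMod 5) = 3 * x.1 + 3} with (x.1 : ZMod 5) = r,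
        ((Int.negOnePow (x.1 + x.2) : ℤ) : R) := by
    rw [coeff_pentagonalPart_mul, filter_filter]
    refine sum_congr (filter_congr fun x _ ↦ ?_) fun _ _ ↦ rfl
    constructor <;> (rintro ⟨h, h'⟩; simp_all)
  simp_rw [map_sum, h]
  rw [sum_fiberwise, map_zero]
  have key (x : ℤ × ℤ) (hx : (x.2 : ZMod 5) = 3 * x.1 + 3) :
      ∃ t, x.2 = 3 * x.1 + 3 + 5 * t := by
    have : ((x.2 - (3 * x.1 + 3) : ℤ) : ZMod 5) = 0 := by push_cast; rw [hx, sub_self]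
    obtain ⟨t, ht⟩ := (ZMod.intCast_zmod_eq_zero_iff_dvd _ 5).mp this
    exact ⟨t, by push_cast at ht; omega⟩
  refine sum_involution
    (fun x _ ↦ ((2 - 3 * x.1 - 4 * x.2) / 5, (3 * x.2 - 4 * x.1 + 1) / 5)) ?_ ?_ ?_ ?_
  all_goals
    rintro ⟨j, k⟩ hx
    rw [mem_filter, mem_pentagonalPairs] at hx
    obtain ⟨hn, hx⟩ := hx
    obtain ⟨t, ht⟩ := key _ hx
    dsimp only at ht hn hx ⊢
    subst ht
    have e₁ : (2 - 3 * j - 4 * (3 * j + 3 + 5 * t)) / 5 = -2 - 3 * j - 4 * t := by omega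
    have e₂ : (3 * (3 * j + 3 + 5 * t) - 4 * j + 1) / 5 = j + 2 + 3 * t := by omega
    simp only [e₁, e₂]
  · rw [show -2 - 3 * j - 4 * t + (j + 2 + 3 * t) =
      (j + (3 * j + 3 + 5 * t)) + 1 + 2 * (-3 * j - 3 * t - 2) by ring, Int.negOnePow_add _ (2 * _),
      Int.negOnePow_two_mul, Int.negOnePow_succ]
    simp
  · intro _ h
    rw [Prod.ext_iff] at h
    dsimp only at h
    omega
  · rw [mem_filter, mem_pentagonalPairs]
    constructor
    · have h₁ := two_mul_natCast_pentagonal j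
      have h₂ := two_mul_natCast_pentagonal (3 * j + 3 + 5 * t)
      have h₃ := two_mul_natCast_pentagonal (-2 - 3 * j - 4 * t)
      have h₄ := two_mul_natCast_pentagonal (j + 2 + 3 * t)
      dsimp only
      zify at hn ⊢
      linarith
    · push_cast
      linear_combination (2 * j + 3 * t + 1 : ZMod 5) * (by decide : (5 : ZMod 5) = 0)
  · rw [Prod.ext_iff]
    dsimp only
    omega

theorem supportedOnResidue_pentagonalPart (r : ZMod 5) :
    SupportedOnResidue 5 (3 * (r * (3 * r - 1))) (pentagonalPart R 5 r) := fun n hn ↦ by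
  rw [pentagonalPart, coeff_mk]
  refine sum_eq_zero fun k hk ↦ absurd ?_ hn
  obtain ⟨-, rfl, rfl⟩ := mem_filter.mp hk
  have h := congrArg (Int.cast : ℤ → ZMod 5) (two_mul_natCast_pentagonal k)
  push_cast at h
  linear_combination 3 * h - (pentagonal k : ZMod 5) * (by decide : (5 : ZMod 5) = 0)

end

/-- The coefficients of `∏ (1 - X ^ i) ^ 4` at exponents `5n + 4` vanish modulo `5`. -/
theorem coeff_pentagonalSeries_pow_four {n : ℕ} (hn : (n : ZMod 5) = 4) :
    coeff n (pentagonalSeries (ZMod 5) ^ 4) = 0 := by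
  obtain ⟨a, b, c, ha, hb, hc, hE, hD⟩ : ∃ a b c : (ZMod 5)⟦X⟧, SupportedOnResidue 5 0 a ∧
      SupportedOnResidue 5 1 b ∧ SupportedOnResidue 5 2 c ∧
      pentagonalSeries (ZMod 5) = a + b + c ∧ a * c + b * b = 0 := by
    have h := supportedOnResidue_pentagonalPart (ZMod 5)
    have hE := sum_pentagonalPart (ZMod 5) 5
    have hD := sum_pentagonalPart_mul_eq_zero (ZMod 5)
    set g := pentagonalPart (ZMod 5) 5
    refine ⟨g 0 + g 2, g 1, g 3 + g 4, (h 0).add (h 2), h 1, (h 3).add (h 4), ?_, ?_⟩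
    · rw [← hE]
      refine (Fin.sum_univ_five g).trans ?_
      change g 0 + g 1 + g 2 + g 3 + g 4 = _
      ring
    · have := (Fin.sum_univ_five fun r : ZMod 5 ↦ g r * g (3 * r + 3)).symm.trans hD
      change g 0 * g 3 + g 1 * g 1 + g 2 * g 4 + g 3 * g 2 + g 4 * g 0 = 0 at this
      linear_combination this
  have h5 : (5 : (ZMod 5)⟦X⟧) = 0 := by
    rw [← map_ofNat (C (R := ZMod 5)), show (OfNat.ofNat 5 : ZMod 5) = 0 by decide, map_zero]
  have hE4 : pentagonalSeries (ZMod 5) ^ 4 =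
      a * a * (a * a) + 4 • (a * a * (a * b)) + 4 • (a * a * (a * c)) + 6 • (a * a * (b * b)) +
      12 • (a * a * (b * c)) + 4 • (a * b * (b * b)) + 12 • (a * b * (c * c)) +
      4 • (a * c * (c * c)) + 4 • (b * b * (b * c)) + 6 • (b * b * (c * c)) +
      4 • (b * c * (c * c)) + c * c * (c * c) := by
    rw [hE]
    linear_combination (6 * (a * c + b * b)) * hD - b ^ 4 * h5
  have hz {r : ZMod 5} {f : (ZMod 5)⟦X⟧} (hf : SupportedOnResidue 5 r f) (hr : 4 ≠ r) :
      coeff n f = 0 := hf n (hn ▸ hr)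
  have haa := ha.mul ha
  have hab := ha.mul hb
  have hac := ha.mul hc
  have hbb := hb.mul hb
  have hbc := hb.mul hc
  have hcc := hc.mul hc
  simp only [hE4, map_add, map_nsmul, hz (haa.mul haa) (by decide), hz (haa.mul hab) (by decide),
    hz (haa.mul hac) (by decide), hz (haa.mul hbb) (by decide), hz (haa.mul hbc) (by decide),
    hz (hab.mul hbb) (by decide), hz (hab.mul hcc) (by decide), hz (hac.mul hcc) (by decide),
    hz (hbb.mul hbc) (by decide), hz (hbb.mul hcc) (by decide), hz (hbc.mul hcc) (by decide),
    hz (hcc.mul hcc) (by decide), smul_zero, add_zero]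

/-- Ramanujan's congruence: for all `n ≥ 0`, the number of partitions of `5n+4`
is divisible by `5`. -/
theorem partition_5n4_mod5 (n : ℕ) : 5 ∣ Fintype.card (Nat.Partition (5 * n + 4)) := by
  have : Fact (Nat.Prime 5) := ⟨Nat.prime_five⟩
  rw [← ZMod.natCast_eq_zero_iff]
  set P : (ZMod 5)⟦X⟧ := PowerSeries.mk fun n ↦ (Fintype.card (Nat.Partition n) : ZMod 5)
  have hP : P = P ^ 5 * pentagonalSeries (ZMod 5) ^ 4 := by
    have h : P * pentagonalSeries (ZMod 5) = 1 := Nat.Partition.mk_card_mul_pentagonalSeries _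
    linear_combination (-P) * congrArg (· ^ 4) h
  rw [← coeff_mk (5 * n + 4) fun n ↦ (Fintype.card (Nat.Partition n) : ZMod 5)]
  change coeff (5 * n + 4) P = 0
  rw [hP, coeff_mul]
  refine sum_eq_zero fun p hp ↦ ?_
  by_cases h₁ : (p.1 : ZMod 5) = 0
  · rw [coeff_pentagonalSeries_pow_four, mul_zero]
    have h := congrArg (Nat.cast : ℕ → ZMod 5) (mem_antidiagonal.mp hp)
    push_cast at h
    rwa [h₁, zero_add, show (5 : ZMod 5) = 0 from rfl, zero_mul, zero_add] at h
  · rw [supportedOnResidue_pow_char 5 P _ h₁, zero_mul]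
end

section
/- For all n ≥ 0, the number of partitions of 7n+5 is divisible by 7. -/
open Finset

section QBinomial

variable {R : Type*} [CommRing R]

/-- The finite `q`-Pochhammer product `(q; q)_n = ∏_{j = 1}^{n} (1 - q ^ j)`. -/
def qPochhammer (q : R) (n : ℕ) : R := ∏ j ∈ range n, (1 - q ^ (j + 1))

theorem qPochhammer_succ (q : R) (n : ℕ) :
    qPochhammer q (n + 1) = qPochhammer q n * (1 - q ^ (n + 1)) :=
  prod_range_succ _ _

/-- The Gaussian binomial coefficient, defined by its Pascal recursion. -/
def gaussBinom (q : R) : ℕ → ℕ → R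
  | _, 0 => 1
  | 0, _ + 1 => 0
  | n + 1, k + 1 => gaussBinom q n k + q ^ (k + 1) * gaussBinom q n (k + 1)

theorem gaussBinom_zero_right (q : R) (n : ℕ) : gaussBinom q n 0 = 1 := by
  cases n <;> rfl

theorem gaussBinom_succ_succ (q : R) (n k : ℕ) :
    gaussBinom q (n + 1) (k + 1) = gaussBinom q n k + q ^ (k + 1) * gaussBinom q n (k + 1) := rfl

theorem gaussBinom_eq_zero_of_lt (q : R) {n k : ℕ} (h : n < k) : gaussBinom q n k = 0 := by
  induction n generalizing k with
  | zero => obtain ⟨k, rfl⟩ := Nat.exists_eq_add_of_lt h; rfl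
  | succ n ih =>
    obtain ⟨k, rfl⟩ := Nat.exists_eq_succ_of_ne_zero (Nat.ne_zero_of_lt h)
    rw [gaussBinom_succ_succ, ih (by omega), ih (by omega)]
    ring

theorem gaussBinom_self (q : R) (n : ℕ) : gaussBinom q n n = 1 := by
  induction n with
  | zero => rfl
  | succ n ih => rw [gaussBinom_succ_succ, ih, gaussBinom_eq_zero_of_lt q n.lt_succ_self]; ring

theorem gaussBinom_add_mul_qPochhammer (q : R) (m k : ℕ) :
    gaussBinom q (m + k) k * (qPochhammer q m * qPochhammer q k) = qPochhammer q (m + k) := by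
  induction m generalizing k with
  | zero => simp [gaussBinom_self, qPochhammer]
  | succ m ihm =>
    induction k with
    | zero => simp [gaussBinom_zero_right, qPochhammer]
    | succ k ihk =>
      have h := ihm (k + 1)
      rw [show m + 1 + k = m + k + 1 by ring] at ihk
      rw [show m + (k + 1) = m + k + 1 by ring] at h
      rw [show m + 1 + (k + 1) = m + k + 1 + 1 by ring, gaussBinom_succ_succ,
        qPochhammer_succ q (m + k + 1)]
      have h₁ := qPochhammer_succ q m
      have h₂ := qPochhammer_succ q k
      linear_combination (1 - q ^ (k + 1)) * ihk + q ^ (k + 1) * (1 - q ^ (m + 1)) * h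
        + gaussBinom q (m + k + 1) k * qPochhammer q (m + 1) * h₂
        + q ^ (k + 1) * gaussBinom q (m + k + 1) (k + 1) * qPochhammer q (k + 1) * h₁

/-- The `q`-binomial theorem. -/
theorem prod_add_mul_pow_eq_sum_gaussBinom (q x y : R) (n : ℕ) :
    ∏ j ∈ range n, (x + y * q ^ j) =
      ∑ k ∈ range (n + 1), gaussBinom q n k * q ^ k.choose 2 * y ^ k * x ^ (n - k) := by
  induction n generalizing y with
  | zero => simp [gaussBinom_zero_right]
  | succ n ih =>
    have hshift : ∏ j ∈ range n, (x + y * q ^ (j + 1)) =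
        ∑ k ∈ range (n + 1),
          gaussBinom q n k * q ^ (k + 1).choose 2 * y ^ k * x ^ (n - k) := by
      calc _ = ∏ j ∈ range n, (x + y * q * q ^ j) := prod_congr rfl fun j _ ↦ by ring
        _ = _ := by
          rw [ih]
          refine sum_congr rfl fun k _ ↦ ?_
          rw [Nat.choose_succ_succ' k 1, Nat.choose_one_right]
          ring
    have hx : x * ∑ k ∈ range (n + 1),
          gaussBinom q n k * q ^ (k + 1).choose 2 * y ^ k * x ^ (n - k) =
        ∑ k ∈ range (n + 1),
          q ^ (k + 1) * gaussBinom q n (k + 1) * q ^ (k + 1).choose 2 * y ^ (k + 1) * x ^ (n - k)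
          + x ^ (n + 1) := by
      rw [sum_range_succ', sum_range_succ _ n, gaussBinom_eq_zero_of_lt q n.lt_succ_self, mul_add,
        mul_sum]
      have : ∀ k ∈ range n, x * (gaussBinom q n (k + 1) * q ^ (k + 1 + 1).choose 2 * y ^ (k + 1)
            * x ^ (n - (k + 1))) =
          q ^ (k + 1) * gaussBinom q n (k + 1) * q ^ (k + 1).choose 2 * y ^ (k + 1)
            * x ^ (n - k) := by
        intro k hk
        rw [Nat.choose_succ_succ' (k + 1) 1, Nat.choose_one_right,
          show n - k = n - (k + 1) + 1 by have := mem_range.1 hk; omega]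
        ring
      rw [sum_congr rfl this]
      simp [gaussBinom_zero_right]
      ring
    have hy : y * ∑ k ∈ range (n + 1),
          gaussBinom q n k * q ^ (k + 1).choose 2 * y ^ k * x ^ (n - k) =
        ∑ k ∈ range (n + 1),
          gaussBinom q n k * q ^ (k + 1).choose 2 * y ^ (k + 1) * x ^ (n - k) := by
      rw [mul_sum]
      exact sum_congr rfl fun k _ ↦ by ring
    rw [prod_range_succ', hshift, sum_range_succ' _ (n + 1), pow_zero, mul_one, mul_add,
      mul_comm _ x, hx, mul_comm _ y, hy]
    simp only [gaussBinom_succ_succ, gaussBinom_zero_right, Nat.add_sub_add_right, add_mul,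
      sum_add_distrib]
    simp
    ring

theorem map_gaussBinom {S : Type*} [CommRing S] (f : R →+* S) (q : R) (n k : ℕ) :
    f (gaussBinom q n k) = gaussBinom (f q) n k := by
  induction n generalizing k with
  | zero => cases k <;> simp [gaussBinom]
  | succ n ih => cases k <;> simp [gaussBinom, ih]

theorem prod_pow_sub_pow_of_lt (q : R) (n : ℕ) :
    ∏ j ∈ range n, (q ^ n - q ^ j) = (-1) ^ n * q ^ n.choose 2 * qPochhammer q n := by
  have h : ∀ j ∈ range n, q ^ n - q ^ j = -1 * q ^ j * (1 - q ^ (n - 1 - j + 1)) := by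
    intro j hj
    have hj := mem_range.1 hj
    have : q ^ n = q ^ j * q ^ (n - 1 - j + 1) := by rw [← pow_add]; congr 1; omega
    rw [this]
    ring
  rw [prod_congr rfl h, prod_mul_distrib, prod_mul_distrib, prod_const, card_range,
    prod_pow_eq_pow_sum, sum_range_id, ← Nat.choose_two_right,
    prod_range_reflect (fun j ↦ 1 - q ^ (j + 1)), qPochhammer]

theorem prod_pow_sub_pow_of_gt (q : R) (n : ℕ) :
    ∏ j ∈ range n, (q ^ n - q ^ (n + 1 + j)) = q ^ (n * n) * qPochhammer q n := by
  have h : ∀ j ∈ range n, q ^ n - q ^ (n + 1 + j) = q ^ n * (1 - q ^ (j + 1)) :=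
    fun j _ ↦ by ring
  rw [prod_congr rfl h, prod_mul_distrib, prod_const, card_range, ← pow_mul, qPochhammer]

/-- The `q`-binomial theorem differentiated at the zero `z = 1` of `∏ (q ^ n - z * q ^ j)`. -/
theorem sum_mul_gaussBinom_eq (q : R) (n : ℕ) :
    ∑ k ∈ range (2 * n + 2),
      (k : R) * ((-1) ^ k * gaussBinom q (2 * n + 1) k
        * q ^ (k.choose 2 + n * (2 * n + 1 - k))) =
      (-1) ^ (n + 1) * q ^ (n.choose 2 + n * n + n) * qPochhammer q n ^ 2 := by
  have key := congrArg (fun p ↦ (Polynomial.derivative p).eval 1)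
    (prod_add_mul_pow_eq_sum_gaussBinom (Polynomial.C q) (Polynomial.C q ^ n)
      (-Polynomial.X) (2 * n + 1))
  have hsplit : ∏ j ∈ range (2 * n + 1),
      ((Polynomial.C q ^ n : Polynomial R) + -Polynomial.X * Polynomial.C q ^ j) =
      (1 - Polynomial.X) * (Polynomial.C q ^ n *
        ((∏ j ∈ range n, (Polynomial.C q ^ n + -Polynomial.X * Polynomial.C q ^ j)) *
        ∏ j ∈ range n, (Polynomial.C q ^ n + -Polynomial.X * Polynomial.C q ^ (n + 1 + j)))) := by
    rw [show 2 * n + 1 = n + 1 + n by ring, prod_range_add, prod_range_succ]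
    ring
  have hterm : ∀ k ∈ range (2 * n + 2), gaussBinom (Polynomial.C q) (2 * n + 1) k *
      Polynomial.C q ^ k.choose 2 * (-Polynomial.X) ^ k *
      (Polynomial.C q ^ n) ^ (2 * n + 1 - k) =
      Polynomial.C ((-1) ^ k * gaussBinom q (2 * n + 1) k
        * q ^ (k.choose 2 + n * (2 * n + 1 - k))) * Polynomial.X ^ k := by
    intro k _
    rw [← map_gaussBinom, neg_pow]
    simp only [map_mul, map_pow, map_neg, map_one]
    ring
  rw [hsplit, sum_congr rfl hterm] at key
  rw [Polynomial.derivative_sum] at key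
  simp only [Polynomial.derivative_C_mul_X_pow] at key
  simp only [Polynomial.eval_finsetSum, Polynomial.derivative_mul, Polynomial.eval_add,
    Polynomial.eval_mul, Polynomial.derivative_sub, Polynomial.derivative_one,
    Polynomial.derivative_X, Polynomial.eval_sub, Polynomial.eval_prod, Polynomial.eval_pow,
    Polynomial.eval_C, Polynomial.eval_X, Polynomial.eval_one, Polynomial.eval_neg,
    neg_one_mul, ← sub_eq_add_neg, one_pow, sub_self,
    zero_mul, mul_one, add_zero, zero_sub] at key
  rw [prod_pow_sub_pow_of_lt, prod_pow_sub_pow_of_gt] at key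
  simp only [mul_comm (Nat.cast _ : R)]
  rw [← key]
  ring

theorem choose_two_add_mul_reflect (n m : ℕ) (h : m ≤ n) :
    (n + 1 + m).choose 2 + n * (2 * n + 1 - (n + 1 + m)) =
      (m + 1).choose 2 + (n.choose 2 + n * n + n) ∧
    (n - m).choose 2 + n * (2 * n + 1 - (n - m)) =
      (m + 1).choose 2 + (n.choose 2 + n * n + n) := by
  obtain ⟨d, rfl⟩ := Nat.exists_eq_add_of_le h
  have hsq : ∀ a b : ℕ, (a + b).choose 2 = a.choose 2 + b.choose 2 + a * b := by
    intro a b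
    induction b with
    | zero => simp
    | succ b ih =>
      rw [← add_assoc, Nat.choose_succ_succ' (a + b) 1, Nat.choose_succ_succ' b 1, ih]
      simp only [Nat.choose_one_right]
      ring
  have hm : m.choose 2 + m.choose 2 + m = m * m := by
    induction m with
    | zero => rfl
    | succ m ih => rw [Nat.choose_succ_succ' m 1, Nat.choose_one_right]; grind
  rw [show 2 * (m + d) + 1 - (m + d + 1 + m) = d by omega,
    show 2 * (m + d) + 1 - (m + d - m) = 2 * m + d + 1 by omega, Nat.add_sub_cancel_left,
    hsq (m + d + 1) m, hsq (m + d) 1, hsq m d, hsq m 1]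
  simp
  constructor <;> nlinarith

theorem gaussBinom_symm [IsDomain R] {q : R} (hq : ∀ n, qPochhammer q n ≠ 0) (m k : ℕ) :
    gaussBinom q (m + k) m = gaussBinom q (m + k) k := by
  have h₁ := gaussBinom_add_mul_qPochhammer q k m
  have h₂ := gaussBinom_add_mul_qPochhammer q m k
  rw [add_comm k m, ← h₂, mul_comm (qPochhammer q k)] at h₁
  exact mul_right_cancel₀ (mul_ne_zero (hq m) (hq k)) h₁

/-- A finite form of Jacobi's identity for the cube of the Euler product. -/
theorem qPochhammer_sq_eq_sum [IsDomain R] {q : R} (hq₀ : q ≠ 0)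
    (hq : ∀ n, qPochhammer q n ≠ 0) (n : ℕ) :
    qPochhammer q n ^ 2 = ∑ m ∈ range (n + 1),
      (-1) ^ m * (2 * m + 1 : R) * q ^ (m + 1).choose 2 *
        gaussBinom q (2 * n + 1) (n + 1 + m) := by
  have key := sum_mul_gaussBinom_eq q n
  rw [show 2 * n + 2 = (n + 1) + (n + 1) by ring, sum_range_add, ← sum_range_reflect,
    ← sum_add_distrib] at key
  apply mul_left_cancel₀ (pow_ne_zero (n.choose 2 + n * n + n) hq₀)
  apply mul_left_cancel₀ (pow_ne_zero (n + 1) (neg_ne_zero.2 (one_ne_zero (α := R))))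
  rw [← mul_assoc, ← key, mul_sum, mul_sum]
  refine sum_congr rfl fun m hm ↦ ?_
  have hm : m ≤ n := Nat.lt_succ_iff.1 (mem_range.1 hm)
  have hsym := gaussBinom_symm hq (n - m) (n + 1 + m)
  rw [show n - m + (n + 1 + m) = 2 * n + 1 by omega] at hsym
  obtain ⟨h₁, h₂⟩ := choose_two_add_mul_reflect n m hm
  rw [Nat.add_sub_cancel, h₁, h₂, hsym]
  obtain ⟨d, rfl⟩ := Nat.exists_eq_add_of_le hm
  have hsign : ((-1 : R) ^ m) ^ 2 = 1 := by rw [← pow_mul, mul_comm, pow_mul]; simp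
  rw [Nat.add_sub_cancel_left]
  push_cast
  simp only [pow_add, pow_one]
  linear_combination ((d : R) * (-1) ^ d * gaussBinom q (2 * (m + d) + 1) (m + d + 1 + m)
    * (q ^ (m + 1).choose 2 * (q ^ (m + d).choose 2 * q ^ ((m + d) * (m + d)) * (q ^ m * q ^ d))))
    * (-hsign)

end QBinomial

namespace PowerSeries

variable {R : Type*} [CommRing R]

theorem constantCoeff_qPochhammer_X (n : ℕ) :
    constantCoeff (qPochhammer (X : R⟦X⟧) n) = 1 := by
  simp [qPochhammer, map_prod]

theorem qPochhammer_X_ne_zero [Nontrivial R] (n : ℕ) : qPochhammer (X : R⟦X⟧) n ≠ 0 := by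
  intro h
  simpa [h] using constantCoeff_qPochhammer_X (R := R) n

theorem isUnit_qPochhammer_X (n : ℕ) : IsUnit (qPochhammer (X : R⟦X⟧) n) := by
  rw [isUnit_iff_constantCoeff, constantCoeff_qPochhammer_X]
  exact isUnit_one

theorem X_pow_dvd_qPochhammer_sub {m n : ℕ} (h : m ≤ n) :
    (X : R⟦X⟧) ^ (m + 1) ∣ qPochhammer X n - qPochhammer X m := by
  induction n, h using Nat.le_induction with
  | base => simp
  | succ n hmn ih =>
    rw [qPochhammer_succ, mul_sub, mul_one, sub_right_comm]
    exact dvd_sub ih ((pow_dvd_pow X (by omega)).mul_left _)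

theorem X_pow_dvd_gaussBinom_mul_qPochhammer_sub_one {m n : ℕ} (h : m ≤ n) :
    (X : R⟦X⟧) ^ (n - m + 1) ∣
      gaussBinom X (2 * n + 1) (n + 1 + m) * qPochhammer X n - 1 := by
  have hmul := gaussBinom_add_mul_qPochhammer (X : R⟦X⟧) (n - m) (n + 1 + m)
  rw [show n - m + (n + 1 + m) = 2 * n + 1 by omega] at hmul
  have h₁ := X_pow_dvd_qPochhammer_sub (R := R) (Nat.sub_le n m)
  have hle : (X : R⟦X⟧) ^ (n - m + 1) ∣ X ^ (n + 1) := pow_dvd_pow X (by omega)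
  have h₂ := hle.trans (X_pow_dvd_qPochhammer_sub (R := R) (show n ≤ n + 1 + m by omega))
  have h₃ := hle.trans (X_pow_dvd_qPochhammer_sub (R := R) (show n ≤ 2 * n + 1 by omega))
  rw [← (isUnit_qPochhammer_X (R := R) n).dvd_mul_right]
  have := (h₁.mul_left (gaussBinom X (2 * n + 1) (n + 1 + m) * qPochhammer X n)).add
    ((h₃.sub (h₂.mul_left (gaussBinom X (2 * n + 1) (n + 1 + m) * qPochhammer X (n - m)))))
  convert this using 1
  linear_combination hmul

/-- Jacobi's identity for the cube of the Euler product, truncated. -/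
theorem X_pow_dvd_qPochhammer_pow_three_sub [IsDomain R] (n : ℕ) :
    (X : R⟦X⟧) ^ (n + 1) ∣ qPochhammer X n ^ 3 -
      ∑ m ∈ range (n + 1), (-1) ^ m * (2 * m + 1 : R⟦X⟧) * X ^ (m + 1).choose 2 := by
  rw [pow_succ (qPochhammer _ _), qPochhammer_sq_eq_sum X_ne_zero qPochhammer_X_ne_zero, sum_mul,
    ← sum_sub_distrib]
  refine dvd_sum fun m hm ↦ ?_
  have hm : m ≤ n := Nat.lt_succ_iff.1 (mem_range.1 hm)
  have hle : n + 1 ≤ (m + 1).choose 2 + (n - m + 1) := by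
    rw [Nat.choose_succ_succ' m 1, Nat.choose_one_right]
    omega
  refine (pow_dvd_pow X hle).trans ?_
  rw [pow_add]
  convert ((mul_dvd_mul_left (X ^ (m + 1).choose 2)
    (X_pow_dvd_gaussBinom_mul_qPochhammer_sub_one hm)).mul_left
      ((-1) ^ m * (2 * m + 1 : R⟦X⟧))) using 1
  ring

open WithPiTopology in
theorem mk_card_partition_mul_pentagonalSeries (R : Type*) [CommRing R] [NoZeroDivisors R] :
    mk (fun n ↦ (Fintype.card n.Partition : R)) * pentagonalSeries R = 1 := by
  let : TopologicalSpace R := ⊥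
  have : DiscreteTopology R := ⟨rfl⟩
  have h := (Nat.Partition.hasProd_powerSeriesMk_card_restricted R fun _ ↦ True).mul
    (hasProd_one_sub_X_pow R)
  have hone : ∀ i : ℕ, (if True then ∑' j : ℕ, (X : R⟦X⟧) ^ ((i + 1) * j) else 1) *
      (1 - X ^ (i + 1)) = 1 := by
    intro i
    simp only [if_true, pow_mul]
    exact tsum_pow_mul_one_sub_of_constantCoeff_eq_zero (by simp)
  simp only [hone] at h
  simpa [Nat.Partition.restricted] using h.unique hasProd_one

theorem X_pow_dvd_pentagonalSeries_sub (n : ℕ) :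
    (X : R⟦X⟧) ^ (n + 1) ∣ pentagonalSeries R - qPochhammer X n := by
  rw [X_pow_dvd_iff]
  intro d hd
  obtain ⟨m, hmn, hm⟩ := ((Filter.eventually_ge_atTop n).and
    (Filter.tendsto_finset_range.eventually (coeff_prod_one_sub_X_pow_eventually_eq R d))).exists
  rw [map_sub, ← hm, ← map_sub]
  exact X_pow_dvd_iff.1 (X_pow_dvd_qPochhammer_sub hmn) d hd

theorem coeff_pow_char_eq_zero {p : ℕ} [Fact p.Prime] [CharP R p] [NoZeroDivisors R]
    (f : R⟦X⟧) {n : ℕ} (h : ¬ p ∣ n) : coeff n (f ^ p) = 0 := by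
  obtain ⟨n, rfl⟩ := Nat.exists_eq_succ_of_ne_zero (n := n) (by rintro rfl; simp at h)
  have hd := congrArg (coeff n) (derivative_pow (R := R) f p)
  have hp : ((p : ℕ) : R⟦X⟧) = 0 := by rw [← map_natCast (C (R := R))]; simp
  rw [coeff_derivative, hp] at hd
  have hn : ((n + 1 : ℕ) : R) ≠ 0 := by rwa [Ne, CharP.cast_eq_zero_iff R p]
  push_cast at hn
  simpa [hn] using hd

end PowerSeries

open PowerSeries

/-- Modulo `7`, the square of the truncated Jacobi series has no terms with exponent `5` modulo `7`,
since `8 * (T i + T j) + 2 = (2 * i + 1) ^ 2 + (2 * j + 1) ^ 2` for triangular numbers `T`. -/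
theorem coeff_jacobi_sq_eq_zero (N b : ℕ) (hb : b % 7 = 5) :
    coeff b ((∑ m ∈ range N,
      (-1) ^ m * (2 * m + 1 : (ZMod 7)⟦X⟧) * X ^ (m + 1).choose 2) ^ 2) = 0 := by
  rw [sq, sum_mul_sum, map_sum]
  refine sum_eq_zero fun i _ ↦ ?_
  rw [map_sum]
  refine sum_eq_zero fun j _ ↦ ?_
  have hC : (-1) ^ i * (2 * i + 1 : (ZMod 7)⟦X⟧) * X ^ (i + 1).choose 2 *
      ((-1) ^ j * (2 * j + 1 : (ZMod 7)⟦X⟧) * X ^ (j + 1).choose 2) =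
      C ((-1) ^ i * (-1) ^ j * ((2 * i + 1) * (2 * j + 1)) : ZMod 7) *
        X ^ ((i + 1).choose 2 + (j + 1).choose 2) := by
    simp only [map_mul, map_pow, map_neg, map_one, map_add, map_natCast, map_ofNat]
    ring
  rw [hC, coeff_C_mul, coeff_X_pow]
  split_ifs with h
  · have hT : ∀ k : ℕ, 2 * ((k + 1).choose 2 : ZMod 7) = k * (k + 1) := by
      intro k
      have := Nat.add_one_mul_choose_eq k 1
      rw [Nat.choose_one_right] at this
      have hk : 2 * (k + 1).choose 2 = k * (k + 1) := by linarith
      simpa using congrArg (Nat.cast : ℕ → ZMod 7) hk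
    have hb' : (b : ZMod 7) = 5 := by
      rw [← ZMod.natCast_mod, hb]; rfl
    have hij : (i : ZMod 7) * (i + 1) + j * (j + 1) = 10 := by
      rw [← hT, ← hT, ← mul_add, ← Nat.cast_add, ← h, hb']; rfl
    have hzero : ∀ x y : ZMod 7, x * (x + 1) + y * (y + 1) = 10 →
      (2 * x + 1) * (2 * y + 1) = 0 := by decide
    rw [hzero _ _ hij]
    simp
  · simp

/-- Ramanujan's congruence: for all `n ≥ 0`, the number of partitions of `7n+5`
is divisible by `7`. -/
theorem partition_7n5_mod7 (n : ℕ) : 7 ∣ Fintype.card (Nat.Partition (7 * n + 5)) := by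
  have : Fact (Nat.Prime 7) := ⟨by norm_num⟩
  set N := 7 * n + 5 with hN
  set P : (ZMod 7)⟦X⟧ := mk fun k ↦ (Fintype.card k.Partition : ZMod 7) with hP
  set J : (ZMod 7)⟦X⟧ := ∑ m ∈ range (N + 1),
    (-1) ^ m * (2 * m + 1 : (ZMod 7)⟦X⟧) * X ^ (m + 1).choose 2 with hJ
  have hPE : P * pentagonalSeries (ZMod 7) = 1 := mk_card_partition_mul_pentagonalSeries _
  have hcube : (X : (ZMod 7)⟦X⟧) ^ (N + 1) ∣ pentagonalSeries (ZMod 7) ^ 3 - J := by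
    have h := ((X_pow_dvd_pentagonalSeries_sub (R := ZMod 7) N).trans
      (sub_dvd_pow_sub_pow _ _ 3)).add (X_pow_dvd_qPochhammer_pow_three_sub N)
    rwa [sub_add_sub_cancel] at h
  have hdvd : (X : (ZMod 7)⟦X⟧) ^ (N + 1) ∣ P - P ^ 7 * J ^ 2 := by
    have h := (hcube.trans (sub_dvd_pow_sub_pow _ _ 2)).mul_left (P ^ 7)
    have hP7 : P ^ 7 * (pentagonalSeries (ZMod 7) ^ 3) ^ 2 = P := by
      rw [show P ^ 7 * (pentagonalSeries (ZMod 7) ^ 3) ^ 2 =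
        P * (P * pentagonalSeries (ZMod 7)) ^ 6 by ring, hPE, one_pow, mul_one]
    rwa [mul_sub, hP7] at h
  have hcoeff := X_pow_dvd_iff.1 hdvd N N.lt_succ_self
  have hzero : coeff N (P ^ 7 * J ^ 2) = 0 := by
    rw [coeff_mul]
    refine sum_eq_zero fun ⟨a, b⟩ hab ↦ ?_
    rw [HasAntidiagonal.mem_antidiagonal] at hab
    by_cases ha : 7 ∣ a
    · rw [hJ, coeff_jacobi_sq_eq_zero _ b (by simp only at hab; omega), mul_zero]
    · rw [coeff_pow_char_eq_zero P ha, zero_mul]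
  rw [map_sub, hzero, sub_zero, hP, coeff_mk] at hcoeff
  exact (ZMod.natCast_eq_zero_iff _ _).1 hcoeff
end

section
/- For all n ≥ 0, a_2(3n+2) ≡ 0 (mod 3), where a_2(n) is the number of cubic partitions of n. -/
/-- The set of generalized cubic partitions of `n` with `c` colors for even parts:
a partition is encoded as a multiset of (part, color) pairs, where each part is positive,
even parts carry a color `< c`, and odd parts carry the single color `0`. -/
def cubicPartitionSet (c n : ℕ) : Set (Multiset (ℕ × ℕ)) :=
  {M | (∀ x ∈ M, 0 < x.1 ∧ (if Even x.1 then x.2 < c else x.2 = 0)) ∧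
    (M.map Prod.fst).sum = n}

/-- `a c n` is the number of generalized cubic partitions of `n` with `c` colors. -/
noncomputable def a (c n : ℕ) : ℕ := (cubicPartitionSet c n).ncard

open Finset PowerSeries Filter
open scoped PowerSeries.WithPiTopology

section ThetaIdentity

variable {R : Type*} [CommRing R]

/-- The partial sum `∑_{|k| ≤ n} (-1)^k q^{k²}` of the theta series of the squares. -/
def squareThetaPartial (q : R) (n : ℕ) : R :=
  1 + ∑ k ∈ range n, 2 * (-1) ^ (k + 1) * q ^ ((k + 1) ^ 2)

/-- The summands of the finite form of Gauss square identity. -/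
def gaussSquareTerm (q : R) (n s : ℕ) : R :=
  (-1) ^ s * q ^ ((n + 1) * s) * (∏ i ∈ range s, (1 + q ^ i)) *
    ∏ j ∈ Ico (s + 1) (n + 1), (1 - q ^ j)

lemma sum_gaussSquareTerm_succ_sub (q : R) (n m : ℕ) (hm : m ≤ n + 1) :
    ∑ s ∈ range m, (gaussSquareTerm q (n + 1) s - (1 + q ^ (n + 1)) * gaussSquareTerm q n s) =
      (-1) ^ m * q ^ ((n + 1) * m) * (∏ i ∈ range m, (1 + q ^ i)) *
        ∏ j ∈ Ico m (n + 1), (1 - q ^ j) := by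
  induction m with
  | zero => simp [prod_range_succ']
  | succ m ih =>
    rw [sum_range_succ, ih (by omega), prod_eq_prod_Ico_succ_bot (show m < n + 1 by omega),
      gaussSquareTerm, gaussSquareTerm, prod_Ico_succ_top (show m + 1 ≤ n + 1 by omega),
      prod_range_succ]
    ring

/-- Finite form of Gauss square identity. -/
lemma prod_one_add_mul_squareThetaPartial (q : R) (n : ℕ) :
    (∏ i ∈ range n, (1 + q ^ (i + 1))) * squareThetaPartial q n =
      ∑ s ∈ range (n + 1), gaussSquareTerm q n s := by
  induction n with
  | zero => simp [squareThetaPartial, gaussSquareTerm]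
  | succ n ih =>
    have h := sum_gaussSquareTerm_succ_sub q n (n + 1) le_rfl
    rw [sum_sub_distrib, ← mul_sum, ← ih, sub_eq_iff_eq_add] at h
    rw [sum_range_succ, h, squareThetaPartial, sum_range_succ, ← add_assoc, ← squareThetaPartial,
      gaussSquareTerm, Ico_self, Ico_self, prod_range_succ _ n, prod_range_succ' _ n]
    simp only [prod_empty, pow_zero]
    ring

lemma pow_dvd_prod_one_add_mul_squareThetaPartial_sub (q : R) (n : ℕ) :
    q ^ (n + 1) ∣ (∏ i ∈ range n, (1 + q ^ (i + 1))) * squareThetaPartial q n -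
      ∏ i ∈ range n, (1 - q ^ (i + 1)) := by
  rw [prod_one_add_mul_squareThetaPartial, sum_range_succ', gaussSquareTerm]
  have h : ∏ i ∈ range n, (1 - q ^ (i + 1)) = ∏ j ∈ Ico 1 (n + 1), (1 - q ^ j) := by
    rw [prod_Ico_eq_prod_range]
    simp [add_comm]
  simp only [h, pow_zero, mul_zero, range_zero, prod_empty, mul_one, one_mul, zero_add,
    add_sub_cancel_right]
  refine dvd_sum fun s _ ↦ ?_
  rw [gaussSquareTerm, mul_add_one, pow_add q]
  exact Dvd.intro_left ((-1) ^ (s + 1) * q ^ ((n + 1) * s) * (∏ i ∈ range (s + 1), (1 + q ^ i)) *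
    ∏ j ∈ Ico (s + 1 + 1) (n + 1), (1 - q ^ j)) (by ring)

end ThetaIdentity

section Bijection

/-- The multisets of positive integers with sum `n`. -/
def partitionFinset (n : ℕ) : Finset (Multiset ℕ) :=
  univ.image (Nat.Partition.parts (n := n))

lemma mem_partitionFinset {n : ℕ} {u : Multiset ℕ} :
    u ∈ partitionFinset n ↔ (∀ x ∈ u, 0 < x) ∧ u.sum = n := by
  simp only [partitionFinset, mem_image, mem_univ, true_and]
  constructor
  · rintro ⟨p, rfl⟩
    exact ⟨fun _ hx ↦ p.parts_pos hx, p.parts_sum⟩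
  · rintro ⟨h, hs⟩
    exact ⟨⟨u, fun hx ↦ h _ hx, hs⟩, rfl⟩

lemma card_partitionFinset (n : ℕ) : #(partitionFinset n) = Fintype.card n.Partition :=
  card_image_of_injective _ fun _ _ h ↦ Nat.Partition.ext h

/-- Merge a partition with a partition whose parts are doubled and given the second color. -/
def mergeColors (p : Multiset ℕ × Multiset ℕ) : Multiset (ℕ × ℕ) :=
  p.1.map (fun i ↦ (i, 0)) + p.2.map (fun i ↦ (2 * i, 1))

lemma mergeColors_injective : Function.Injective mergeColors := by
  have h : Function.LeftInverse (fun M : Multiset (ℕ × ℕ) ↦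
      ((M.filter (·.2 = 0)).map Prod.fst, (M.filter (·.2 = 1)).map (·.1 / 2))) mergeColors := by
    rintro ⟨u, v⟩
    simp [mergeColors, Multiset.filter_map]
  exact h.injective

lemma cubicPartitionSet_two_eq_image (n : ℕ) :
    cubicPartitionSet 2 n = ((((antidiagonal n).filter (2 ∣ ·.2)).biUnion fun x ↦
      partitionFinset x.1 ×ˢ partitionFinset (x.2 / 2)).image mergeColors :
        Finset (Multiset (ℕ × ℕ))) := by
  ext M
  simp only [cubicPartitionSet, Set.mem_ofPred_eq, coe_image, Set.mem_image, SetLike.mem_coe,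
    mem_biUnion, mem_filter, HasAntidiagonal.mem_antidiagonal, mem_product, mem_partitionFinset,
    Prod.exists]
  constructor
  · rintro ⟨hM, hn⟩
    have hmerge : mergeColors ((M.filter (·.2 = 0)).map Prod.fst,
        (M.filter (¬ ·.2 = 0)).map (·.1 / 2)) = M := by
      rw [mergeColors, Multiset.map_map, Multiset.map_map]
      conv_rhs => rw [← Multiset.filter_add_not (·.2 = 0) M]
      congr 1
      · conv_rhs => rw [← Multiset.map_id (M.filter (·.2 = 0))]
        refine Multiset.map_congr rfl fun x hx ↦ ?_
        ext <;> simp [(Multiset.mem_filter.1 hx).2]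
      · conv_rhs => rw [← Multiset.map_id (M.filter (¬ ·.2 = 0))]
        refine Multiset.map_congr rfl fun x hx ↦ ?_
        have hx' := Multiset.mem_filter.1 hx
        have := (hM x hx'.1).2
        ext <;> simp only [Function.comp, id] <;> grind
    refine ⟨_, _, ⟨_, 2 * ((M.filter (¬ ·.2 = 0)).map (·.1 / 2)).sum,
      ⟨?_, dvd_mul_right _ _⟩, ⟨?_, rfl⟩, ?_, by simp⟩, hmerge⟩
    · rw [← hn]
      conv_rhs => rw [← hmerge]
      simp [mergeColors, Multiset.sum_map_mul_left]
    · simp only [Multiset.mem_map, Multiset.mem_filter]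
      rintro _ ⟨x, ⟨hx, -⟩, rfl⟩
      exact (hM x hx).1
    · simp only [Multiset.mem_map, Multiset.mem_filter]
      rintro _ ⟨x, ⟨hx, hx2⟩, rfl⟩
      have := hM x hx
      grind
  · rintro ⟨u, v, ⟨i, j, ⟨rfl, k, rfl⟩, ⟨hu, rfl⟩, hv, hvs⟩, rfl⟩
    constructor
    · simp only [mergeColors, Multiset.mem_add, Multiset.mem_map]
      rintro x (⟨y, hy, rfl⟩ | ⟨y, hy, rfl⟩)
      · simp [hu y hy]
      · simp [hv y hy]
    · simp only [Nat.mul_div_cancel_left _ Nat.two_pos] at hvs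
      simpa [mergeColors, hvs] using Multiset.sum_map_mul_left (s := v) (a := 2) (f := id)

lemma a_two_eq_sum (n : ℕ) :
    a 2 n = ∑ x ∈ antidiagonal n with 2 ∣ x.2,
      Fintype.card x.1.Partition * Fintype.card (x.2 / 2).Partition := by
  rw [a, cubicPartitionSet_two_eq_image, Set.ncard_coe_finset,
    card_image_of_injective _ mergeColors_injective, card_biUnion]
  · simp [card_partitionFinset]
  · intro x hx y hy hxy
    rw [Function.onFun, Finset.disjoint_left]
    rintro ⟨u, v⟩ h1 h2
    simp only [mem_product, mem_partitionFinset] at h1 h2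
    apply hxy
    ext
    · exact h1.1.2.symm.trans h2.1.2
    · have := h1.2.2.symm.trans h2.2.2
      have := (mem_filter.1 hx).2
      have := (mem_filter.1 hy).2
      omega

end Bijection

section GaussSquare

variable (R : Type*) [CommRing R] [TopologicalSpace R]

lemma summable_squareTheta_tail :
    Summable fun k : ℕ ↦ (2 * (-1) ^ (k + 1) * X ^ ((k + 1) ^ 2) : R⟦X⟧) := by
  nontriviality R
  refine WithPiTopology.summable_of_tendsto_order_atTop_nhds_top R
    (ENat.tendsto_nhds_top_iff_natCast_lt.mpr fun n ↦ eventually_atTop.mpr ⟨n, fun m hm ↦ ?_⟩)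
  grw [← le_order_mul, order_X_pow]
  refine lt_add_of_nonneg_of_lt (by simp) ?_
  norm_cast
  nlinarith

lemma multipliable_one_add_X_pow : Multipliable fun n ↦ (1 : R⟦X⟧) + X ^ (n + 1) := by
  nontriviality R
  refine WithPiTopology.multipliable_one_add_of_tendsto_order_atTop_nhds_top R
    (ENat.tendsto_nhds_top_iff_natCast_lt.mpr fun n ↦ eventually_atTop.mpr ⟨n, fun m hm ↦ ?_⟩)
  rw [order_X_pow]
  norm_cast
  omega

/-- The theta series `∑_{k ∈ ℤ} (-1)^k X^{k²}`. -/
noncomputable def squareTheta : R⟦X⟧ :=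
  1 + ∑' k : ℕ, 2 * (-1) ^ (k + 1) * X ^ ((k + 1) ^ 2)

lemma coeff_squareTheta_eq_zero [T2Space R] {n : ℕ} (hn : ¬ IsSquare n) :
    (squareTheta R).coeff n = 0 := by
  have h0 : n ≠ 0 := fun h ↦ hn (h ▸ IsSquare.zero)
  rw [squareTheta, map_add,
    (summable_squareTheta_tail R).map_tsum _ (WithPiTopology.continuous_coeff R n), coeff_one,
    if_neg h0, zero_add]
  convert tsum_zero with k
  have hk : n ≠ (k + 1) ^ 2 := fun h ↦ hn (h ▸ IsSquare.sq _)
  have hc : (2 * (-1) ^ (k + 1) : R⟦X⟧) = C (2 * (-1) ^ (k + 1)) := by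
    simp [map_ofNat]
  rw [hc, coeff_C_mul, coeff_X_pow, if_neg hk, mul_zero]

lemma continuous_expand {p : ℕ} (hp : p ≠ 0) : Continuous (expand p hp : R⟦X⟧ → R⟦X⟧) := by
  refine continuous_iff_continuousAt.2 fun f ↦
    (WithPiTopology.tendsto_iff_coeff_tendsto _ _ _ _).2 fun d ↦ ?_
  simp only [coeff_expand]
  split_ifs
  · exact (WithPiTopology.continuous_coeff R _).continuousAt
  · exact tendsto_const_nhds

variable [IsTopologicalRing R]

lemma tendsto_squareThetaPartial :
    Tendsto (squareThetaPartial (X : R⟦X⟧)) atTop (nhds (squareTheta R)) :=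
  (summable_squareTheta_tail R).hasSum.tendsto_sum_nat.const_add 1

variable [T2Space R]

/-- **Gauss square identity**. -/
lemma tprod_one_add_X_pow_mul_squareTheta :
    (∏' n, (1 + X ^ (n + 1) : R⟦X⟧)) * squareTheta R = ∏' n, (1 - X ^ (n + 1)) := by
  have h := ((multipliable_one_add_X_pow R).hasProd.tendsto_prod_nat.mul
    (tendsto_squareThetaPartial R)).sub
    (WithPiTopology.multipliable_one_sub_X_pow R).hasProd.tendsto_prod_nat
  refine sub_eq_zero.1 (tendsto_nhds_unique h ?_)
  rw [WithPiTopology.tendsto_iff_coeff_tendsto]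
  refine fun d ↦ tendsto_atTop_of_eventually_const (i₀ := d) fun n hn ↦ ?_
  rw [map_zero]
  exact X_pow_dvd_iff.1 (pow_dvd_prod_one_add_mul_squareThetaPartial_sub X n) d (by omega)

lemma expand_two_tprod_one_sub_X_pow :
    expand 2 two_ne_zero (∏' n, (1 - X ^ (n + 1) : R⟦X⟧)) =
      (∏' n, (1 - X ^ (n + 1))) * ∏' n, (1 + X ^ (n + 1)) := by
  rw [(WithPiTopology.multipliable_one_sub_X_pow R).map_tprod _ (continuous_expand R two_ne_zero),
    ← (WithPiTopology.multipliable_one_sub_X_pow R).tprod_mul (multipliable_one_add_X_pow R)]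
  refine tprod_congr fun n ↦ ?_
  simp only [map_sub, map_one, map_pow, expand_X]
  ring

/-- The generating function of the partition numbers. -/
noncomputable def partitionSeries : R⟦X⟧ :=
  PowerSeries.mk fun n ↦ (Fintype.card n.Partition : R)

lemma partitionSeries_mul_tprod : partitionSeries R * ∏' n, (1 - X ^ (n + 1)) = 1 := by
  have h := Nat.Partition.hasProd_powerSeriesMk_card_restricted R fun _ ↦ True
  have hP : PowerSeries.mk (fun n ↦ (#(Nat.Partition.restricted n fun _ ↦ True) : R)) =
      partitionSeries R := by
    simp [partitionSeries, Nat.Partition.restricted]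
  rw [hP] at h
  rw [← h.tprod_eq, ← h.multipliable.tprod_mul (WithPiTopology.multipliable_one_sub_X_pow R)]
  simp only [if_true, pow_mul]
  simp [WithPiTopology.tsum_pow_mul_one_sub_of_constantCoeff_eq_zero]

lemma mul_expand_partitionSeries :
    partitionSeries R * expand 2 two_ne_zero (partitionSeries R) =
      partitionSeries R ^ 3 * squareTheta R := by
  have h1 := partitionSeries_mul_tprod R
  have h2 := congrArg (expand 2 two_ne_zero) h1
  rw [map_mul, map_one, expand_two_tprod_one_sub_X_pow] at h2
  have h3 := tprod_one_add_X_pow_mul_squareTheta R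
  grind

end GaussSquare

lemma coeff_mul_expand_partitionSeries (R : Type*) [CommRing R] (n : ℕ) :
    (partitionSeries R * expand 2 two_ne_zero (partitionSeries R)).coeff n = (a 2 n : R) := by
  rw [coeff_mul, a_two_eq_sum, sum_filter, Nat.cast_sum]
  refine sum_congr rfl fun x _ ↦ ?_
  rw [coeff_expand]
  split_ifs <;> simp [partitionSeries]

lemma pow_eq_expand_of_zmod (p : ℕ) [Fact p.Prime] (f : (ZMod p)⟦X⟧) :
    f ^ p = expand p (NeZero.ne p) f := by
  have h := MvPowerSeries.map_frobenius_expand p (NeZero.ne p) (f := f)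
  rw [ZMod.frobenius_zmod, MvPowerSeries.map_id] at h
  exact h.symm

/-- Chan's congruence: for all `n ≥ 0`, `a_2(3n+2) ≡ 0 (mod 3)`. -/
theorem cubic_3n2_mod3 (n : ℕ) : 3 ∣ a 2 (3 * n + 2) := by
  rw [← ZMod.natCast_eq_zero_iff, ← coeff_mul_expand_partitionSeries, mul_expand_partitionSeries,
    pow_eq_expand_of_zmod, coeff_mul]
  refine sum_eq_zero fun x hx ↦ ?_
  rw [HasAntidiagonal.mem_antidiagonal] at hx
  by_cases h3 : 3 ∣ x.1
  · rw [coeff_squareTheta_eq_zero, mul_zero]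
    rintro ⟨k, hk⟩
    have h2 : k * k % 3 = 2 := by omega
    have : k % 3 < 3 := Nat.mod_lt _ (by norm_num)
    rw [Nat.mul_mod] at h2
    interval_cases k % 3 <;> omega
  · rw [coeff_expand_of_not_dvd _ _ _ h3, zero_mul]
end

section
/- Let p be an odd prime and let r be an integer with 1 ≤ r ≤ p-1 such that 8r+1 is a quadratic nonresidue modulo p. Then for all n ≥ 0, a_{p-1}(pn+r) ≡ 0 (mod p). -/
open PowerSeries in
/-- The generating function of multisets with elements in `S`, graded by total weight `w`. -/
noncomputable def multisetGenFun (R : Type*) [CommRing R] {α : Type*} (w : α → ℕ)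
    (S : Finset α) : PowerSeries R :=
  PowerSeries.mk fun n ↦ (({M : Multiset α | (∀ x ∈ M, x ∈ S) ∧ (M.map w).sum = n}.ncard : ℕ) : R)

theorem finite_multisets_of_weight {α : Type*} [DecidableEq α] (w : α → ℕ) (S : Finset α)
    (hw : ∀ x ∈ S, 0 < w x) (n : ℕ) :
    {M : Multiset α | (∀ x ∈ M, x ∈ S) ∧ (M.map w).sum = n}.Finite := by
  refine (Set.finite_Iic (n • S.val)).subset ?_
  rintro M ⟨hM, hn⟩
  rw [Set.mem_Iic, Multiset.le_iff_count]
  intro x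
  by_cases hx : x ∈ M
  · have hcard : M.card ≤ (M.map w).sum := by
      have h := Multiset.card_nsmul_le_sum (s := M.map w) (a := 1) (by
        intro y hy
        obtain ⟨z, hz, rfl⟩ := Multiset.mem_map.1 hy
        exact hw z (hM z hz))
      simpa using h
    have h1 := Multiset.count_le_card x M
    rw [Multiset.count_nsmul, Multiset.count_eq_one_of_mem S.nodup (hM x hx)]
    simp only [mul_one]
    omega
  · simp [Multiset.count_eq_zero_of_notMem hx]

theorem multisetGenFun_insert_mul (R : Type*) [CommRing R] {α : Type*} [DecidableEq α]
    (w : α → ℕ) (S : Finset α) (x : α) (hx : x ∉ S) (hw : ∀ y ∈ insert x S, 0 < w y) :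
    multisetGenFun R w (insert x S) * (1 - PowerSeries.X ^ w x) = multisetGenFun R w S := by
  ext n
  rw [mul_sub, mul_one, map_sub, PowerSeries.coeff_mul_X_pow', sub_eq_iff_eq_add]
  simp only [multisetGenFun, PowerSeries.coeff_mk]
  have hfinS := finite_multisets_of_weight w S (fun y hy ↦ hw y (Finset.mem_insert_of_mem hy)) n
  split_ifs with hn
  · rw [← Nat.cast_add, ← Set.ncard_image_of_injective
        {M : Multiset α | (∀ y ∈ M, y ∈ insert x S) ∧ (M.map w).sum = n - w x} (f := (x ::ₘ ·)) (fun _ _ h ↦ (Multiset.cons_inj_right x).1 h),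
      ← Set.ncard_union_eq ?_ hfinS ((finite_multisets_of_weight w _ hw _).image _)]
    · congr 2
      ext M
      simp only [Set.mem_union, Set.mem_image, Set.mem_ofPred_eq]
      constructor
      · rintro ⟨hM, hs⟩
        by_cases hxM : x ∈ M
        · right
          obtain ⟨M, rfl⟩ := Multiset.exists_cons_of_mem hxM
          refine ⟨M, ⟨fun y hy ↦ hM y (Multiset.mem_cons_of_mem hy), ?_⟩, rfl⟩
          simp only [Multiset.map_cons, Multiset.sum_cons] at hs
          omega
        · left
          refine ⟨fun y hy ↦ (Finset.mem_insert.1 (hM y hy)).resolve_left ?_, hs⟩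
          rintro rfl
          exact hxM hy
      · rintro (⟨hM, hs⟩ | ⟨M, ⟨hM, hs⟩, rfl⟩)
        · exact ⟨fun y hy ↦ Finset.mem_insert_of_mem (hM y hy), hs⟩
        · refine ⟨fun y hy ↦ ?_, ?_⟩
          · rcases Multiset.mem_cons.1 hy with rfl | hy
            · exact Finset.mem_insert_self _ _
            · exact hM y hy
          · simp only [Multiset.map_cons, Multiset.sum_cons]
            omega
    · rw [Set.disjoint_left]
      rintro _ ⟨hM, -⟩ ⟨M, -, rfl⟩
      exact hx (hM x (Multiset.mem_cons_self x M))
  · rw [add_zero]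
    congr 2
    ext M
    simp only [Set.mem_ofPred_eq]
    refine ⟨?_, fun ⟨hM, hs⟩ ↦ ⟨fun y hy ↦ Finset.mem_insert_of_mem (hM y hy), hs⟩⟩
    rintro ⟨hM, hs⟩
    refine ⟨fun y hy ↦ (Finset.mem_insert.1 (hM y hy)).resolve_left ?_, hs⟩
    rintro rfl
    exact hn (hs ▸ Multiset.le_sum_of_mem (Multiset.mem_map_of_mem w hy))

theorem multisetGenFun_mul_prod (R : Type*) [CommRing R] {α : Type*} [DecidableEq α]
    (w : α → ℕ) (S : Finset α) (hw : ∀ y ∈ S, 0 < w y) :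
    multisetGenFun R w S * ∏ x ∈ S, (1 - PowerSeries.X ^ w x) = 1 := by
  induction S using Finset.induction_on with
  | empty =>
    ext n
    simp only [multisetGenFun, Finset.prod_empty, mul_one, PowerSeries.coeff_mk,
      PowerSeries.coeff_one, Finset.notMem_empty]
    split_ifs with hn
    · subst hn
      rw [show {M : Multiset α | (∀ x ∈ M, False) ∧ (M.map w).sum = 0} = {0} by
        ext M
        simp only [Set.mem_ofPred_eq, Set.mem_singleton_iff]
        refine ⟨fun h ↦ Multiset.eq_zero_of_forall_notMem h.1, ?_⟩
        rintro rfl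
        simp]
      simp
    · rw [show {M : Multiset α | (∀ x ∈ M, False) ∧ (M.map w).sum = n} = ∅ by
        ext M
        simp only [Set.mem_ofPred_eq, Set.mem_empty_iff_false, iff_false]
        rintro ⟨hM, hs⟩
        rw [Multiset.eq_zero_of_forall_notMem hM] at hs
        exact hn hs.symm]
      simp
  | insert x S hx ih =>
    rw [Finset.prod_insert hx, ← mul_assoc, multisetGenFun_insert_mul R w S x hx hw]
    exact ih fun y hy ↦ hw y (Finset.mem_insert_of_mem hy)

/-- The colored parts of size at most `2 * m`. -/
def coloredParts (c m : ℕ) : Finset (ℕ × ℕ) :=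
  (Finset.Ico 1 (2 * m + 1) ×ˢ Finset.range c).filter fun x ↦ Even x.1 ∨ x.2 = 0

theorem cubicPartitionSet_eq {c : ℕ} (hc : 0 < c) {n m : ℕ} (hnm : n ≤ 2 * m) :
    cubicPartitionSet c n =
      {M | (∀ x ∈ M, x ∈ coloredParts c m) ∧ (M.map Prod.fst).sum = n} := by
  ext M
  simp only [cubicPartitionSet, Set.mem_ofPred_eq]
  refine and_congr_left fun hs ↦ forall₂_congr fun x hx ↦ ?_
  have hle : x.1 ≤ n := hs ▸ Multiset.le_sum_of_mem (Multiset.mem_map_of_mem Prod.fst hx)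
  simp only [coloredParts, Finset.mem_filter, Finset.mem_product, Finset.mem_Ico,
    Finset.mem_range]
  split_ifs with h
  · simp only [h, true_or, and_true]
    omega
  · simp only [h, false_or]
    omega

theorem prod_coloredParts {R : Type*} [CommRing R] {c : ℕ} (hc : 0 < c) (f : ℕ → R) (m : ℕ) :
    ∏ x ∈ coloredParts c m, f x.1 =
      ∏ k ∈ Finset.range m, (f (2 * k + 1) * f (2 * k + 2) ^ c) := by
  rw [coloredParts, Finset.prod_filter, Finset.prod_product]
  induction m with
  | zero => simp
  | succ m ih =>
    rw [show 2 * (m + 1) + 1 = 2 * m + 1 + 1 + 1 by ring,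
      Finset.prod_Ico_succ_top (by omega), Finset.prod_Ico_succ_top (by omega), ih,
      Finset.prod_range_succ, mul_assoc]
    have h1 : ¬ Even (2 * m + 1) := by simp
    have h2 : Even (2 * m + 1 + 1) := ⟨m + 1, by ring⟩
    simp [h1, h2, hc]

section Gauss

variable {R : Type*} [CommRing R] (x : R) (u : ℕ → R)

/-- The quotients of partial products of `∏ (1 - x ^ (2 * k + 2)) / (1 - x ^ (2 * k + 1))`,
where `u k` stands for the inverse of `1 - x ^ (2 * k + 1)`. -/
def gaussProd (s n : ℕ) : R := ∏ k ∈ Finset.Ico s n, (1 - x ^ (2 * k + 2)) * u k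

theorem sum_gaussProd_succ_sub (hu : ∀ k, (1 - x ^ (2 * k + 1)) * u k = 1) {m n : ℕ}
    (hmn : m ≤ n) :
    ∑ s ∈ Finset.range m, (gaussProd x u s (n + 1) * x ^ (s * (2 * n + 3)) -
      gaussProd x u s n * x ^ (s * (2 * n + 1))) =
      u n * (gaussProd x u m n * x ^ (m * (2 * n + 1)) * (1 - x ^ (2 * m))) := by
  induction m with
  | zero => simp
  | succ m ih =>
    rw [Finset.sum_range_succ, ih (by omega)]
    have h1 : gaussProd x u m (n + 1) = gaussProd x u m n * ((1 - x ^ (2 * n + 2)) * u n) :=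
      Finset.prod_Ico_succ_top (by omega) _
    have h2 : gaussProd x u m n = (1 - x ^ (2 * m + 2)) * u m * gaussProd x u (m + 1) n :=
      Finset.prod_eq_prod_Ico_succ_bot (by omega) _
    rw [h1, h2]
    have hm := hu m
    have hn := hu n
    generalize gaussProd x u (m + 1) n = g
    have e1 : x ^ (m * (2 * n + 3)) = x ^ (m * (2 * n + 1)) * x ^ (2 * m) := by ring
    have e2 : x ^ ((m + 1) * (2 * n + 1)) = x ^ (m * (2 * n + 1)) * x ^ (2 * n + 1) := by ring
    rw [e1, e2]
    generalize x ^ (m * (2 * n + 1)) = y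
    simp only [pow_succ, mul_add, mul_one] at hm hn ⊢
    generalize x ^ (2 * m) = z at *
    generalize x ^ (2 * n) = t at *
    linear_combination (u n * g * y * t * x * (1 - z * x * x)) * hm +
      (g * y * (1 - z * x * x) * u m) * hn

/-- Shanks' finite form of Gauss' identity for triangular numbers. -/
theorem sum_gaussProd (hu : ∀ k, (1 - x ^ (2 * k + 1)) * u k = 1) (n : ℕ) :
    ∑ s ∈ Finset.range n, gaussProd x u s n * x ^ (s * (2 * n + 1)) =
      ∑ k ∈ Finset.range n, x ^ (k * (2 * k + 1)) * (1 + x ^ (2 * k + 1)) := by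
  induction n with
  | zero => simp
  | succ n ih =>
    have h := sum_gaussProd_succ_sub x u hu (le_refl n)
    rw [Finset.sum_sub_distrib, ih] at h
    rw [Finset.sum_range_succ, Finset.sum_range_succ, show 2 * (n + 1) + 1 = 2 * n + 3 by ring,
      sub_eq_iff_eq_add.1 h]
    have hn := hu n
    have e1 : x ^ (n * (2 * n + 3)) = x ^ (n * (2 * n + 1)) * x ^ (2 * n) := by ring
    simp only [gaussProd, Finset.Ico_self, Finset.prod_empty, Nat.Ico_succ_singleton,
      Finset.prod_singleton, e1]
    generalize x ^ (n * (2 * n + 1)) = y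
    simp only [pow_succ] at hn ⊢
    generalize x ^ (2 * n) = t at *
    linear_combination y * (1 + t * x) * hn

end Gauss

open PowerSeries in
/-- The product side of Gauss' identity has no coefficients outside the triangular numbers. -/
theorem coeff_gaussProd_eq_zero {R : Type*} [CommRing R] (u : ℕ → PowerSeries R)
    (hu : ∀ k, (1 - X ^ (2 * k + 1)) * u k = 1) {i m : ℕ} (him : i ≤ 2 * m)
    (hi : ¬ IsSquare (8 * i + 1)) : coeff i (gaussProd X u 0 m) = 0 := by
  rcases m with _ | m
  · obtain rfl : i = 0 := by omega
    exact absurd ⟨1, rfl⟩ hi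
  have h := congrArg (coeff i) (sum_gaussProd X u hu (m + 1))
  rw [Finset.sum_range_succ', map_add, map_sum, map_sum, Finset.sum_eq_zero, zero_add,
    Finset.sum_eq_zero] at h
  · simpa using h
  · intro k _
    rw [mul_add, mul_one, ← pow_add, map_add, coeff_X_pow, coeff_X_pow, if_neg, if_neg, add_zero]
    · rintro rfl
      exact hi ⟨4 * k + 3, by ring⟩
    · rintro rfl
      exact hi ⟨4 * k + 1, by ring⟩
  · intro s _
    rw [coeff_mul_X_pow', if_neg]
    nlinarith

open PowerSeries in
/-- Dividing by series in `X ^ p` preserves the vanishing of coefficients in a residue class. -/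
theorem coeff_eq_zero_of_mul_prod {R : Type*} [CommRing R] {p r N : ℕ} (hp : 0 < p)
    (G : PowerSeries R) (m : ℕ)
    (h : ∀ i ≤ N, (i : ZMod p) = r →
      coeff i (G * ∏ k ∈ Finset.range m, (1 - X ^ (p * (2 * k + 2)))) = 0) :
    ∀ i ≤ N, (i : ZMod p) = r → coeff i G = 0 := by
  induction m with
  | zero => simpa using h
  | succ m ih =>
    apply ih
    rw [Finset.prod_range_succ, ← mul_assoc] at h
    generalize G * ∏ k ∈ Finset.range m, (1 - X ^ (p * (2 * k + 2))) = H at h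
    intro i
    induction i using Nat.strong_induction_on with
    | _ i ihi =>
      intro hiN hir
      have hi := h i hiN hir
      rw [mul_sub, mul_one, map_sub, coeff_mul_X_pow'] at hi
      split_ifs at hi with hle
      · have hpos : 0 < p * (2 * m + 2) := by positivity
        rwa [ihi (i - p * (2 * m + 2)) (by omega) (by omega)
          (by rw [Nat.cast_sub hle]; simp [hir]), sub_zero] at hi
      · rwa [sub_zero] at hi

/-- For an odd prime `p` and `1 ≤ r ≤ p-1` with `8r+1` a quadratic nonresidue mod `p`,
`a_{p-1}(pn+r) ≡ 0 (mod p)` for all `n ≥ 0`. -/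
theorem a_pred_cong (p : ℕ) (hp : p.Prime) (hodd : Odd p) (r : ℕ)
    (hr1 : 1 ≤ r) (hr2 : r ≤ p - 1)
    (hnr : ¬ IsSquare ((8 * r + 1 : ℕ) : ZMod p)) (n : ℕ) :
    p ∣ a (p - 1) (p * n + r) := by
  have : Fact p.Prime := ⟨hp⟩
  set N := p * n + r with hN
  have hc : 0 < p - 1 := by omega
  have hNN : N ≤ 2 * N := by omega
  set F := multisetGenFun (ZMod p) Prod.fst (coloredParts (p - 1) N) with hF
  have haF : ((a (p - 1) N : ℕ) : ZMod p) = PowerSeries.coeff N F := by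
    rw [a, cubicPartitionSet_eq hc hNN, hF, multisetGenFun, PowerSeries.coeff_mk]
  rw [← ZMod.natCast_eq_zero_iff, haF]
  have hF1 := multisetGenFun_mul_prod (ZMod p) Prod.fst (coloredParts (p - 1) N) (by
    intro y hy
    simp only [coloredParts, Finset.mem_filter, Finset.mem_product, Finset.mem_Ico] at hy
    omega)
  rw [prod_coloredParts hc fun j ↦ (1 - PowerSeries.X ^ j : PowerSeries (ZMod p)), ← hF] at hF1
  let u : ℕ → PowerSeries (ZMod p) := fun k ↦ (1 - PowerSeries.X ^ (2 * k + 1))⁻¹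
  have hu : ∀ k, (1 - PowerSeries.X ^ (2 * k + 1)) * u k = 1 := fun k ↦
    PowerSeries.mul_inv_cancel _ (by simp)
  have hprod : F * ∏ k ∈ Finset.range N, (1 - PowerSeries.X ^ (p * (2 * k + 2))) =
      gaussProd PowerSeries.X u 0 N := by
    refine Eq.trans ?_ ((mul_assoc F _ _).symm.trans
      ((congrArg (· * gaussProd PowerSeries.X u 0 N) hF1).trans (one_mul _)))
    rw [gaussProd, ← Finset.range_eq_Ico, ← Finset.prod_mul_distrib]
    congr 1
    refine Finset.prod_congr rfl fun k _ ↦ ?_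
    have hchar : (1 - PowerSeries.X ^ (p * (2 * k + 2)) : PowerSeries (ZMod p)) =
        (1 - PowerSeries.X ^ (2 * k + 2)) ^ (p - 1) * (1 - PowerSeries.X ^ (2 * k + 2)) := by
      have : CharP (PowerSeries (ZMod p)) p := charP_of_injective_algebraMap
        (algebraMap (ZMod p) (PowerSeries (ZMod p))).injective p
      rw [← pow_succ, Nat.sub_add_cancel hp.one_le, sub_pow_char, one_pow, ← pow_mul, mul_comm p]
    rw [hchar]
    linear_combination (-(1 - PowerSeries.X ^ (2 * k + 2)) ^ (p - 1) *
      (1 - PowerSeries.X ^ (2 * k + 2))) * hu k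
  refine coeff_eq_zero_of_mul_prod hp.pos F N (r := r) (fun i hi hir ↦ ?_) N le_rfl (by simp [hN])
  rw [hprod]
  refine coeff_gaussProd_eq_zero u hu (by omega) fun hsq ↦ hnr ?_
  have h := hsq.map (Nat.castRingHom (ZMod p))
  simpa [hir] using h
end

section
/- For all n ≥ 0, a_3(7n+4) ≡ 0 (mod 7), where a_3(n) is the number of partitions of n in which even parts may appear in 3 colors. -/
open Finset PowerSeries

section QSeries

variable {R : Type*} [CommRing R]

/-- The `q`-Pochhammer symbol `(q; q)_n`. -/
def qFactorial (q : R) (n : ℕ) : R := ∏ i ∈ range n, (1 - q ^ (i + 1))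

lemma qFactorial_succ (q : R) (n : ℕ) :
    qFactorial q (n + 1) = qFactorial q n * (1 - q ^ (n + 1)) :=
  prod_range_succ _ _

/-- The Gaussian binomial coefficient of `2 n + 1` over `n - k`, through the recurrence in `n`
that it inherits from the two Pascal rules. -/
def centralGauss (q : R) : ℕ → ℕ → R
  | 0, 0 => 1
  | 0, _ + 1 => 0
  | n + 1, 0 =>
    (1 + q ^ (2 * n + 2) + q ^ (n + 1)) * centralGauss q n 0 + q ^ (n + 2) * centralGauss q n 1
  | n + 1, k + 1 =>
    (1 + q ^ (2 * n + 2)) * centralGauss q n (k + 1) + q ^ (n - k) * centralGauss q n k +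
      q ^ (n + k + 3) * centralGauss q n (k + 2)

lemma centralGauss_eq_zero (q : R) {n k : ℕ} (h : n < k) : centralGauss q n k = 0 := by
  induction n generalizing k with
  | zero =>
    obtain ⟨k, rfl⟩ := Nat.exists_eq_add_of_lt h
    simp [centralGauss]
  | succ n ih =>
    obtain ⟨k, rfl⟩ : ∃ j, k = j + 1 := ⟨k - 1, by omega⟩
    rw [centralGauss, ih (by omega), ih (by omega), ih (by omega)]
    simp

lemma centralGauss_mul_qFactorial (q : R) {n k j : ℕ} (h : k + j = n) :
    centralGauss q n k * qFactorial q j * qFactorial q (2 * k + j + 1) =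
      qFactorial q (2 * n + 1) := by
  induction n generalizing k j with
  | zero =>
    obtain ⟨rfl, rfl⟩ : k = 0 ∧ j = 0 := by omega
    simp [centralGauss, qFactorial]
  | succ n ih =>
    have ih₁ {k j : ℕ} (h : k + j = n) :
        centralGauss q n (k + 1) * qFactorial q j * qFactorial q (2 * k + j + 2) =
          qFactorial q (2 * n + 1) * (1 - q ^ j) := by
      rcases j with _ | j
      · simp [centralGauss_eq_zero q (show n < k + 1 by omega)]
      · rw [← ih (show k + 1 + j = n by omega), qFactorial_succ,
          show 2 * (k + 1) + j + 1 = 2 * k + (j + 1) + 2 by ring]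
        ring
    have ih₂ {k j : ℕ} (h : k + j = n) :
        centralGauss q n (k + 2) * qFactorial q j * qFactorial q (2 * k + j + 3) =
          qFactorial q (2 * n + 1) * (1 - q ^ j) * (1 - q ^ (j - 1)) := by
      rcases j with _ | j
      · simp [centralGauss_eq_zero q (show n < k + 2 by omega)]
      · rw [Nat.add_sub_cancel, mul_right_comm (qFactorial q (2 * n + 1)),
          ← ih₁ (show k + 1 + j = n by omega), qFactorial_succ, show 2 * (k + 1) + j + 2 = 2 * k + (j + 1) + 3 by ring]
        ring
    rw [show 2 * (n + 1) + 1 = 2 * n + 1 + 1 + 1 by ring, qFactorial_succ q (2 * n + 1 + 1),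
      qFactorial_succ q (2 * n + 1)]
    rcases k with _ | k
    · obtain rfl : j = n + 1 := by omega
      have e₀ := ih (zero_add n)
      have e₁ := ih₁ (zero_add n)
      simp only [mul_zero, zero_add, qFactorial_succ q n, qFactorial_succ q (n + 1)] at e₀ e₁ ⊢
      rw [centralGauss]
      linear_combination (1 + q ^ (2 * n + 2) + q ^ (n + 1)) * (1 - q ^ (n + 1)) *
        (1 - q ^ (n + 2)) * e₀ + q ^ (n + 2) * (1 - q ^ (n + 1)) * e₁
    · obtain rfl : n = k + j := by omega
      have e₀ := ih (k := k) (j := j) rfl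
      have e₁ := ih₁ (k := k) (j := j) rfl
      have e₂ := ih₂ (k := k) (j := j) rfl
      rw [show 2 * (k + 1) + j + 1 = 2 * k + j + 3 by ring, centralGauss, Nat.add_sub_cancel_left]
      rw [qFactorial_succ q (2 * k + j + 2), qFactorial_succ q (2 * k + j + 1)] at e₂ ⊢
      rw [qFactorial_succ q (2 * k + j + 1)] at e₁
      have key : (1 + q ^ (2 * (k + j) + 2)) * (1 - q ^ (2 * k + j + 3)) * (1 - q ^ j) +
          q ^ j * (1 - q ^ (2 * k + j + 2)) * (1 - q ^ (2 * k + j + 3)) +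
          q ^ (k + j + k + 3) * ((1 - q ^ j) * (1 - q ^ (j - 1))) =
          (1 - q ^ (2 * (k + j) + 2)) * (1 - q ^ (2 * (k + j) + 3)) := by
        rcases j with _ | j
        · ring
        · rw [Nat.add_sub_cancel]
          ring
      linear_combination (1 + q ^ (2 * (k + j) + 2)) * (1 - q ^ (2 * k + j + 3)) * e₁ +
        q ^ j * (1 - q ^ (2 * k + j + 2)) * (1 - q ^ (2 * k + j + 3)) * e₀ +
        q ^ (k + j + k + 3) * e₂ + qFactorial q (2 * (k + j) + 1) * key

lemma sum_centralGauss_succ (q t : R) (u : ℕ → R) (h0 : u 0 = 1) (h1 : u 1 = 1 + t)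
    (hu : ∀ k, u (k + 2) = t * u (k + 1) - u k) (a : ℕ → R)
    (ha : ∀ k, a (k + 1) = -(a k * q ^ (k + 1))) (n m : ℕ) :
    ∑ k ∈ range (m + 1), a k * u k * centralGauss q (n + 1) k =
      (1 - t * q ^ (n + 1) + q ^ (2 * n + 2)) *
        ∑ k ∈ range (m + 1), a k * u k * centralGauss q n k +
      q ^ (n + 1) * (a m * u (m + 1) * centralGauss q n m -
        a (m + 1) * u m * centralGauss q n (m + 1)) := by
  induction m with
  | zero =>
    simp [centralGauss, h0, h1, ha]
    ring
  | succ m ih =>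
    rw [sum_range_succ, ih, sum_range_succ _ (m + 1), centralGauss, hu, ha (m + 1), ha m]
    rcases le_or_gt m n with h | h
    · obtain ⟨d, rfl⟩ := Nat.exists_eq_add_of_le h
      rw [Nat.add_sub_cancel_left]
      ring
    · rw [centralGauss_eq_zero q h]
      ring

lemma sum_centralGauss (q t : R) (u : ℕ → R) (h0 : u 0 = 1) (h1 : u 1 = 1 + t)
    (hu : ∀ k, u (k + 2) = t * u (k + 1) - u k) (a : ℕ → R) (ha0 : a 0 = 1)
    (ha : ∀ k, a (k + 1) = -(a k * q ^ (k + 1))) (n : ℕ) :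
    ∑ k ∈ range (n + 1), a k * u k * centralGauss q n k =
      ∏ i ∈ range n, (1 - t * q ^ (i + 1) + q ^ (2 * i + 2)) := by
  induction n with
  | zero => simp [centralGauss, h0, ha0]
  | succ n ih =>
    rw [sum_centralGauss_succ q t u h0 h1 hu a ha, sum_range_succ,
      centralGauss_eq_zero q (Nat.lt_succ_self n), centralGauss_eq_zero q (by omega : n < n + 2),
      ih, prod_range_succ]
    ring

lemma dvd_qFactorial_sub (q : R) {j m : ℕ} (h : j ≤ m) :
    q ^ (j + 1) ∣ qFactorial q m - qFactorial q j := by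
  induction m, h using Nat.le_induction with
  | base => simp
  | succ m h ih =>
    rw [qFactorial_succ, show qFactorial q m * (1 - q ^ (m + 1)) - qFactorial q j =
      qFactorial q m - qFactorial q j - q ^ (m + 1) * qFactorial q m by ring]
    exact dvd_sub ih (dvd_mul_of_dvd_left (pow_dvd_pow q (by omega)) _)

lemma isCoprime_pow_qFactorial (q : R) (i j : ℕ) : IsCoprime (q ^ i) (qFactorial q j) := by
  refine IsCoprime.pow_left (IsCoprime.prod_right fun k _ => ⟨q ^ k, 1, ?_⟩)
  ring

lemma dvd_centralGauss_mul_qFactorial_sub_one (q : R) (k j : ℕ) :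
    q ^ (j + 1) ∣ centralGauss q (k + j) k * qFactorial q (k + j) - 1 := by
  obtain ⟨a, ha⟩ := dvd_qFactorial_sub q (show j ≤ 2 * (k + j) + 1 by omega)
  obtain ⟨b, hb⟩ := dvd_qFactorial_sub q (show j ≤ 2 * k + j + 1 by omega)
  obtain ⟨c, hc⟩ := dvd_qFactorial_sub q (show j ≤ k + j by omega)
  have h := centralGauss_mul_qFactorial q (rfl : k + j = k + j)
  have hd : q ^ (j + 1) ∣ centralGauss q (k + j) k * qFactorial q j - 1 := by
    refine (isCoprime_pow_qFactorial q (j + 1) j).dvd_of_dvd_mul_left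
      ⟨a - centralGauss q (k + j) k * qFactorial q j * b, ?_⟩
    linear_combination h + ha - centralGauss q (k + j) k * qFactorial q j * hb
  obtain ⟨d, hd⟩ := hd
  exact ⟨d + centralGauss q (k + j) k * c,
    by linear_combination hd + centralGauss q (k + j) k * hc⟩

lemma triangle_succ (k : ℕ) : (k + 1) * (k + 1 + 1) / 2 = k * (k + 1) / 2 + (k + 1) := by
  rw [show (k + 1) * (k + 1 + 1) = k * (k + 1) + 2 * (k + 1) by ring,
    Nat.add_mul_div_left _ _ two_pos]

lemma le_triangle (k : ℕ) : k ≤ k * (k + 1) / 2 := by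
  rcases k with _ | k
  · simp
  · rw [triangle_succ]
    omega

/-- A truncated form of the Jacobi triple product identity. -/
lemma truncated_triple_product (q t : R) (u : ℕ → R) (h0 : u 0 = 1) (h1 : u 1 = 1 + t)
    (hu : ∀ k, u (k + 2) = t * u (k + 1) - u k) (n : ℕ) :
    q ^ (n + 1) ∣ qFactorial q n * ∏ i ∈ range n, (1 - t * q ^ (i + 1) + q ^ (2 * i + 2)) -
      ∑ k ∈ range (n + 1), (-1) ^ k * q ^ (k * (k + 1) / 2) * u k := by
  rw [← sum_centralGauss q t u h0 h1 hu (fun k => (-1) ^ k * q ^ (k * (k + 1) / 2)) (by simp)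
    (fun k => by rw [triangle_succ]; ring), mul_sum, ← sum_sub_distrib]
  refine dvd_sum fun k hk => ?_
  obtain ⟨j, rfl⟩ := Nat.exists_eq_add_of_le (Nat.lt_succ_iff.mp (mem_range.mp hk))
  have h : q ^ (k + j + 1) ∣ q ^ (k * (k + 1) / 2) *
      (centralGauss q (k + j) k * qFactorial q (k + j) - 1) := by
    rw [add_assoc, pow_add]
    exact mul_dvd_mul (pow_dvd_pow q (le_triangle k)) (dvd_centralGauss_mul_qFactorial_sub_one q k j)
  convert dvd_mul_of_dvd_right h ((-1) ^ k * u k) using 1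
  ring

/-- A truncated form of Jacobi's identity for the cube of the Euler product. -/
lemma truncated_jacobi (q : R) (n : ℕ) :
    q ^ (n + 1) ∣ qFactorial q n ^ 3 -
      ∑ k ∈ range (n + 1), (-1) ^ k * q ^ (k * (k + 1) / 2) * (2 * k + 1) := by
  convert truncated_triple_product q 2 (fun k => 2 * (k : R) + 1) (by simp) (by norm_num)
    (fun k => by push_cast; ring) n using 2
  rw [pow_succ', qFactorial, ← prod_pow]
  congr 1
  exact prod_congr rfl fun i _ => by ring

/-- A truncated form of Gauss's identity for triangular numbers. -/
lemma truncated_gauss (q : R) (n : ℕ) :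
    q ^ (n + 1) ∣ qFactorial q n * (∏ i ∈ range n, (1 + q ^ (i + 1))) ^ 2 -
      ∑ k ∈ range (n + 1), q ^ (k * (k + 1) / 2) := by
  convert truncated_triple_product q (-2) (fun k => (-1) ^ k) (by simp) (by norm_num)
    (fun k => by ring) n using 2
  · rw [← prod_pow]
    congr 1
    exact prod_congr rfl fun i _ => by ring
  · refine sum_congr rfl fun k _ => ?_
    rw [mul_right_comm, ← mul_pow]
    simp

end QSeries

section WeightedMultisets

variable {ι : Type*} [DecidableEq ι]

/-- The multisets of elements of `S` of total weight `n`. -/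
def weightedMultisets (w : ι → ℕ) (S : Finset ι) (n : ℕ) : Set (Multiset ι) :=
  {M | (∀ x ∈ M, x ∈ S) ∧ (M.map w).sum = n}

lemma weightedMultisets_insert_of_lt (w : ι → ℕ) (S : Finset ι) {s : ι} {n : ℕ} (h : n < w s) :
    weightedMultisets w (insert s S) n = weightedMultisets w S n := by
  ext M
  refine and_congr_left fun hM => forall₂_congr fun x hx => ?_
  have : w x ≤ n := hM ▸ Multiset.single_le_sum (by simp) _ (Multiset.mem_map_of_mem w hx)
  have hxs : x ≠ s := by rintro rfl; omega
  simp [hxs]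

lemma weightedMultisets_insert_add (w : ι → ℕ) (S : Finset ι) (s : ι) (n : ℕ) :
    weightedMultisets w (insert s S) (n + w s) = weightedMultisets w S (n + w s) ∪
      (s ::ₘ ·) '' weightedMultisets w (insert s S) n := by
  ext M
  constructor
  · rintro ⟨hM, hsum⟩
    by_cases hs : s ∈ M
    · obtain ⟨M, rfl⟩ := Multiset.exists_cons_of_mem hs
      refine Or.inr ⟨M, ⟨fun x hx => hM x (Multiset.mem_cons_of_mem hx), ?_⟩, rfl⟩
      simp at hsum
      omega
    · refine Or.inl ⟨fun x hx => ?_, hsum⟩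
      exact (mem_insert.mp (hM x hx)).resolve_left (by rintro rfl; exact hs hx)
  · rintro (⟨hM, hsum⟩ | ⟨M, ⟨hM, hsum⟩, rfl⟩)
    · exact ⟨fun x hx => mem_insert_of_mem (hM x hx), hsum⟩
    · refine ⟨fun x hx => ?_, by simp [hsum, add_comm]⟩
      rcases Multiset.mem_cons.mp hx with rfl | hx
      · exact mem_insert_self _ _
      · exact hM x hx

lemma finite_weightedMultisets (w : ι → ℕ) (S : Finset ι) (hS : ∀ s ∈ S, 0 < w s) (n : ℕ) :
    (weightedMultisets w S n).Finite := by
  induction S using Finset.induction_on generalizing n with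
  | empty =>
    refine (Set.finite_singleton 0).subset fun M hM => ?_
    exact Multiset.eq_zero_of_forall_notMem fun x hx => by simpa using hM.1 x hx
  | insert s S hs ih =>
    have ih := ih fun x hx => hS x (mem_insert_of_mem hx)
    have hpos := hS s (mem_insert_self _ _)
    induction n using Nat.strong_induction_on with
    | _ n ihn =>
      rcases lt_or_ge n (w s) with h | h
      · rw [weightedMultisets_insert_of_lt w S h]
        exact ih n
      · obtain ⟨m, rfl⟩ := Nat.exists_eq_add_of_le' h
        rw [weightedMultisets_insert_add]
        exact (ih _).union ((ihn m (by omega)).image _)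

lemma ncard_weightedMultisets_insert_add (w : ι → ℕ) {S : Finset ι} {s : ι} (hs : s ∉ S)
    (hS : ∀ x ∈ insert s S, 0 < w x) (n : ℕ) :
    (weightedMultisets w (insert s S) (n + w s)).ncard =
      (weightedMultisets w S (n + w s)).ncard + (weightedMultisets w (insert s S) n).ncard := by
  have hdisj : Disjoint (weightedMultisets w S (n + w s))
      ((s ::ₘ ·) '' weightedMultisets w (insert s S) n) := by
    rw [Set.disjoint_left]
    rintro _ hM ⟨M, -, rfl⟩
    exact hs (hM.1 s (Multiset.mem_cons_self _ _))
  rw [weightedMultisets_insert_add, Set.ncard_union_eq hdisj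
    (finite_weightedMultisets w S (fun x hx => hS x (mem_insert_of_mem hx)) _)
    ((finite_weightedMultisets w _ hS n).image _),
    Set.ncard_image_of_injective _ fun _ _ h => (Multiset.cons_inj_right s).mp h]

lemma mk_ncard_weightedMultisets_mul_prod (R : Type*) [CommRing R] (w : ι → ℕ) (S : Finset ι)
    (hS : ∀ s ∈ S, 0 < w s) :
    (PowerSeries.mk fun n => ((weightedMultisets w S n).ncard : R)) *
      ∏ s ∈ S, (1 - (X : R⟦X⟧) ^ w s) = 1 := by
  induction S using Finset.induction_on with
  | empty =>
    ext n
    have h : weightedMultisets w ∅ n = if n = 0 then {0} else ∅ := by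
      ext M
      split_ifs with hn
      · simp only [weightedMultisets, notMem_empty, Set.mem_ofPred_eq, Set.mem_singleton_iff]
        refine ⟨fun hM => Multiset.eq_zero_of_forall_notMem hM.1, ?_⟩
        rintro rfl
        simp [hn]
      · simp only [weightedMultisets, notMem_empty, Set.mem_ofPred_eq, Set.mem_empty_iff_false,
          iff_false]
        rintro ⟨hM, hsum⟩
        obtain rfl := Multiset.eq_zero_of_forall_notMem hM
        exact hn (by simpa using hsum.symm)
    simp only [prod_empty, mul_one, coeff_mk, h, coeff_one]
    split_ifs <;> simp
  | insert s S hs ih =>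
    rw [prod_insert hs, ← mul_assoc]
    refine Eq.trans (congrArg (· * _) ?_) (ih fun x hx => hS x (mem_insert_of_mem hx))
    ext n
    rw [mul_sub, mul_one, map_sub, coeff_mul_X_pow', coeff_mk, coeff_mk]
    split_ifs with h
    · obtain ⟨m, rfl⟩ := Nat.exists_eq_add_of_le' h
      rw [coeff_mk, ncard_weightedMultisets_insert_add w hs hS, Nat.add_sub_cancel]
      push_cast
      ring
    · rw [weightedMultisets_insert_of_lt w S (not_le.mp h), sub_zero, coeff_mk]

end WeightedMultisets

/-- The coloured parts available to a partition of `n` whose even parts come in three colours. -/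
def colouredParts (n : ℕ) : Finset (ℕ × ℕ) :=
  (range n).image (fun i => (i + 1, 0)) ∪
    ((range n).image (fun i => (2 * (i + 1), 1)) ∪ (range n).image (fun i => (2 * (i + 1), 2)))

lemma cubicPartitionSet_three (n : ℕ) :
    cubicPartitionSet 3 n = weightedMultisets Prod.fst (colouredParts n) n := by
  ext M
  refine and_congr_left fun hM => forall₂_congr fun x hx => ?_
  have hle : x.1 ≤ n :=
    hM ▸ Multiset.single_le_sum (by simp) _ (Multiset.mem_map_of_mem Prod.fst hx)
  obtain ⟨k, c⟩ := x
  simp only [colouredParts, mem_union, mem_image, mem_range, Prod.mk.injEq] at hle ⊢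
  constructor
  · rintro ⟨hk, hc⟩
    split_ifs at hc with he
    · obtain ⟨r, rfl⟩ := he
      interval_cases c
      · exact Or.inl ⟨r + r - 1, by omega, by omega, rfl⟩
      · exact Or.inr (Or.inl ⟨r - 1, by omega, by omega, rfl⟩)
      · exact Or.inr (Or.inr ⟨r - 1, by omega, by omega, rfl⟩)
    · exact Or.inl ⟨k - 1, by omega, by omega, hc.symm⟩
  · rintro (⟨i, -, rfl, rfl⟩ | ⟨i, -, rfl, rfl⟩ | ⟨i, -, rfl, rfl⟩)
    · simp
    · simp
    · simp

lemma prod_colouredParts {R : Type*} [CommRing R] (n : ℕ) (q : R) :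
    ∏ s ∈ colouredParts n, (1 - q ^ s.1) = qFactorial q n * qFactorial (q ^ 2) n ^ 2 := by
  rw [colouredParts, prod_union, prod_union, prod_image, prod_image, prod_image]
  · simp only [qFactorial, ← pow_mul]
    ring
  all_goals first
    | (intro i _ j _ h; simp at h; omega)
    | (rw [disjoint_left]; simp; try grind)

lemma coeff_pow_seven_eq_zero (f : (ZMod 7)⟦X⟧) {m : ℕ} (hm : ¬ 7 ∣ m) : coeff m (f ^ 7) = 0 := by
  have : Fact (Nat.Prime 7) := ⟨by norm_num⟩
  have h : PowerSeries.map (frobenius (ZMod 7) 7) (f.expand 7 (by norm_num)) = f ^ 7 :=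
    MvPowerSeries.map_frobenius_expand 7 (by norm_num)
  rw [← h, coeff_map, coeff_expand_of_not_dvd _ _ _ hm, map_zero]

lemma coeff_theta_mul_eq_zero (N M m : ℕ) (hm : m % 7 = 4) :
    coeff m ((∑ k ∈ range N, (X : (ZMod 7)⟦X⟧) ^ (k * (k + 1) / 2)) *
      ∑ l ∈ range M, (-1) ^ l * ((X : (ZMod 7)⟦X⟧) ^ 2) ^ (l * (l + 1) / 2) * (2 * l + 1)) = 0 := by
  rw [sum_mul_sum, map_sum]
  refine sum_eq_zero fun k _ => ?_
  rw [map_sum]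
  refine sum_eq_zero fun l _ => ?_
  obtain ⟨a, ha⟩ : ∃ a, a = k * (k + 1) / 2 := ⟨_, rfl⟩
  obtain ⟨b, hb⟩ : ∃ b, b = l * (l + 1) / 2 := ⟨_, rfl⟩
  have ha' : 2 * a = k * (k + 1) := ha ▸ Nat.two_mul_div_two_of_even (Nat.even_mul_succ_self k)
  have hb' : 2 * b = l * (l + 1) := hb ▸ Nat.two_mul_div_two_of_even (Nat.even_mul_succ_self l)
  have hterm : (X : (ZMod 7)⟦X⟧) ^ a * ((-1) ^ l * (X ^ 2) ^ b * (2 * (l : (ZMod 7)⟦X⟧) + 1)) =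
      C ((-1) ^ l * (2 * (l : ZMod 7) + 1)) * X ^ (a + 2 * b) := by
    simp only [map_mul, map_pow, map_neg, map_one, map_add, map_natCast, map_ofNat]
    ring
  rw [← ha, ← hb, hterm, coeff_C_mul, coeff_X_pow]
  split_ifs with h
  · have key : ∀ a k l : ZMod 7, 2 * a = k * (k + 1) → a + l * (l + 1) = 4 → 2 * l + 1 = 0 := by
      decide
    have hm4 : ((a + l * (l + 1) : ℕ) : ZMod 7) = (4 : ℕ) := by
      rw [ZMod.natCast_eq_natCast_iff]
      rw [← hb', ← h]
      exact hm
    rw [key a k l (by exact_mod_cast congrArg (Nat.cast : ℕ → ZMod 7) ha')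
      (by exact_mod_cast hm4)]
    simp
  · simp

lemma coeff_eq_zero_of_mul_pow_seven (f g : (ZMod 7)⟦X⟧) (hg : constantCoeff g = 1) (r N : ℕ)
    (h : ∀ m ≤ N, m % 7 = r → coeff m (f * g ^ 7) = 0) :
    ∀ m ≤ N, m % 7 = r → coeff m f = 0 := by
  intro m
  induction m using Nat.strong_induction_on with
  | _ m ih =>
    intro hm hr
    have hz := h m hm hr
    rw [coeff_mul, sum_eq_single (m, 0)] at hz
    · simpa [hg] using hz
    · rintro ⟨i, j⟩ hij hne
      rw [HasAntidiagonal.mem_antidiagonal] at hij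
      simp only at hij
      by_cases hj : 7 ∣ j
      · have : j ≠ 0 := by rintro rfl; exact hne (by simpa using hij)
        rw [ih i (by omega) (by omega) (by omega), zero_mul]
      · rw [coeff_pow_seven_eq_zero g hj, mul_zero]
    · simp

/-- For all `n ≥ 0`, `a_3(7n+4) ≡ 0 (mod 7)`. -/
theorem a3_7n4_mod7 (n : ℕ) : 7 ∣ a 3 (7 * n + 4) := by
  obtain ⟨N, hN⟩ : ∃ N, N = 7 * n + 4 := ⟨_, rfl⟩
  rw [← hN, ← ZMod.natCast_eq_zero_iff, a, cubicPartitionSet_three]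
  set A : (ZMod 7)⟦X⟧ :=
    PowerSeries.mk fun m => ((weightedMultisets Prod.fst (colouredParts N) m).ncard : ZMod 7)
    with hA
  have hpos : ∀ s ∈ colouredParts N, 0 < s.1 := by
    simp only [colouredParts, mem_union, mem_image]
    rintro s (⟨i, -, rfl⟩ | ⟨i, -, rfl⟩ | ⟨i, -, rfl⟩) <;> simp
  have hAP := mk_ncard_weightedMultisets_mul_prod (ZMod 7) Prod.fst (colouredParts N) hpos
  rw [prod_colouredParts, ← hA] at hAP
  have hP2 : qFactorial ((X : (ZMod 7)⟦X⟧) ^ 2) N =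
      qFactorial X N * ∏ i ∈ range N, (1 + (X : (ZMod 7)⟦X⟧) ^ (i + 1)) := by
    rw [qFactorial, qFactorial, ← prod_mul_distrib]
    exact prod_congr rfl fun i _ => by ring
  obtain ⟨c, hc⟩ := truncated_gauss (X : (ZMod 7)⟦X⟧) N
  obtain ⟨d, hd⟩ := truncated_jacobi ((X : (ZMod 7)⟦X⟧) ^ 2) N
  set P := qFactorial (X : (ZMod 7)⟦X⟧) N
  set Q := qFactorial ((X : (ZMod 7)⟦X⟧) ^ 2) N with hQ
  set U := ∏ i ∈ range N, (1 + (X : (ZMod 7)⟦X⟧) ^ (i + 1))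
  set θ := ∑ k ∈ range (N + 1), (X : (ZMod 7)⟦X⟧) ^ (k * (k + 1) / 2) with hθ
  set J := ∑ k ∈ range (N + 1),
    (-1) ^ k * ((X : (ZMod 7)⟦X⟧) ^ 2) ^ (k * (k + 1) / 2) * (2 * k + 1) with hJ
  have hprod : A * Q ^ 7 = (P * U ^ 2) * Q ^ 3 := by
    linear_combination (P * U ^ 2) * Q ^ 3 * hAP + A * Q ^ 5 * (Q + P * U) * hP2
  have hdvd : X ^ (N + 1) ∣ A * Q ^ 7 - θ * J :=
    ⟨c * Q ^ 3 + θ * X ^ (N + 1) * d, by linear_combination hprod + Q ^ 3 * hc + θ * hd⟩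
  have hQ1 : constantCoeff Q = 1 := by
    simp [hQ, qFactorial]
  have hcoeff : coeff N A = 0 := by
    refine coeff_eq_zero_of_mul_pow_seven A Q hQ1 4 N (fun m hm hr => ?_) N le_rfl (by omega)
    have hz := X_pow_dvd_iff.mp hdvd m (by omega)
    rw [map_sub, hθ, hJ, coeff_theta_mul_eq_zero _ _ m hr, sub_zero] at hz
    exact hz
  rwa [hA, coeff_mk] at hcoeff
end

section
/- Let p ≥ 3 be prime, let r with 1 ≤ r ≤ p-1 be a quadratic nonresidue modulo p, and let k be a positive integer. Then for all n ≥ 0, ā_{kp-1}(pn+r) ≡ 0 (mod p). -/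
/-- The set of generalized overcubic partitions of `n` with `c` colors for even parts:
an overpartition is encoded as a multiset of non-overlined (part, color) pairs together
with a finset of overlined (part, color) pairs (at most one overlined occurrence of each
colored part); parts are positive, even parts carry a color `< c`, odd parts the color `0`. -/
def overcubicSet (c n : ℕ) : Set (Multiset (ℕ × ℕ) × Finset (ℕ × ℕ)) :=
  {P | (∀ x ∈ P.1, 0 < x.1 ∧ (if Even x.1 then x.2 < c else x.2 = 0)) ∧
       (∀ x ∈ P.2, 0 < x.1 ∧ (if Even x.1 then x.2 < c else x.2 = 0)) ∧
       (P.1.map Prod.fst).sum + ∑ x ∈ P.2, x.1 = n}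

/-- `abar c n` is the number of generalized overcubic partitions of `n` with `c` colors. -/
noncomputable def abar (c n : ℕ) : ℕ := (overcubicSet c n).ncard

section

open PowerSeries

/-- A finite form of the Gauss identity `∏ (1 - q ^ i) / (1 + q ^ i) = ∑ (-1) ^ j * q ^ (j ^ 2)`:
`P n` is the partial product and `a s` is `(-1) ^ s (-1; q)_s / (q; q)_s`. -/
theorem gauss_partial {R : Type*} [CommRing R] [IsDomain R] {q : R}
    (hplus : ∀ n, 1 + q ^ (n + 1) ≠ 0) {P a : ℕ → R} (hP0 : P 0 = 1) (ha0 : a 0 = 1)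
    (hP : ∀ n, P (n + 1) * (1 + q ^ (n + 1)) = P n * (1 - q ^ (n + 1)))
    (ha : ∀ n, a (n + 1) * (1 - q ^ (n + 1)) = -(a n * (1 + q ^ n))) (n : ℕ) :
    P n * ∑ s ∈ Finset.range (n + 1), a s * q ^ (s * (n + 1)) =
      1 + 2 * ∑ j ∈ Finset.range n, (-1) ^ (j + 1) * q ^ ((j + 1) ^ 2) := by
  have htel : ∀ n m : ℕ, ∑ s ∈ Finset.range (m + 1), a s * q ^ (s * n) *
      (q ^ s * (1 - q ^ n) - (1 + q ^ n)) = -(a m * (1 + q ^ m) * q ^ ((m + 1) * n)) := by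
    intro n m
    induction m with
    | zero => simp [ha0]; ring
    | succ m ih =>
      rw [Finset.sum_range_succ, ih]
      linear_combination (-q ^ ((m + 1) * n)) * ha m
  have hprod : ∀ n, P n * a (n + 1) * (1 - q ^ (n + 1)) = 2 * (-1) ^ (n + 1) := by
    intro n
    induction n with
    | zero =>
      have := ha 0
      simp only [hP0, ha0] at *
      linear_combination this
    | succ n ih =>
      apply mul_right_cancel₀ (hplus n)
      linear_combination a (n + 2) * (1 - q ^ (n + 2)) * hP n +
        P n * (1 - q ^ (n + 1)) * ha (n + 1) - (1 + q ^ (n + 1)) * ih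
  induction n with
  | zero => simp [hP0, ha0]
  | succ n ih =>
    rw [Finset.sum_range_succ _ n, mul_add, ← add_assoc, ← ih]
    apply mul_right_cancel₀ (hplus n)
    have h1 := htel (n + 1) n
    have h2 : ∑ s ∈ Finset.range (n + 1), a s * q ^ (s * (n + 1)) *
        (q ^ s * (1 - q ^ (n + 1)) - (1 + q ^ (n + 1))) =
        (1 - q ^ (n + 1)) * ∑ s ∈ Finset.range (n + 1), a s * q ^ (s * (n + 1 + 1)) -
        (1 + q ^ (n + 1)) * ∑ s ∈ Finset.range (n + 1), a s * q ^ (s * (n + 1)) := by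
      rw [Finset.mul_sum, Finset.mul_sum, ← Finset.sum_sub_distrib]
      exact Finset.sum_congr rfl fun s _ => by ring
    rw [h2] at h1
    rw [Finset.sum_range_succ _ (n + 1)]
    linear_combination P n * h1 + (∑ s ∈ Finset.range (n + 1), a s * q ^ (s * (n + 1 + 1)) +
      a (n + 1) * q ^ ((n + 1) * (n + 1 + 1))) * hP n +
      q ^ ((n + 1) ^ 2) * (1 + q ^ (n + 1)) * hprod n - P n * q ^ ((n + 1) ^ 2) * ha n

/-- In characteristic `p`, a `p`-th power is supported on multiples of `p`. -/
theorem coeff_pow_char {R : Type*} [CommRing R] [IsDomain R] (p : ℕ) [CharP R p] (f : R⟦X⟧)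
    {n : ℕ} (hn : ¬ p ∣ n) : coeff n (f ^ p) = 0 := by
  obtain _ | n := n
  · simp at hn
  have h : coeff n (derivative R (f ^ p)) = 0 := by
    rw [Derivation.leibniz_pow]
    simp [← Nat.cast_smul_eq_nsmul R]
  rw [coeff_derivative, mul_eq_zero] at h
  refine h.resolve_right fun h => hn ?_
  rw [← CharP.cast_eq_zero_iff R p]
  exact_mod_cast h

/-- Pairs of a multiset on `S` and a subset of `T` of total weight `n`. -/
def weightedPairs {ι : Type*} (w : ι → ℕ) (S T : Finset ι) (n : ℕ) : Set (Multiset ι × Finset ι) :=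
  {P | (∀ x ∈ P.1, x ∈ S) ∧ (∀ x ∈ P.2, x ∈ T) ∧ (P.1.map w).sum + ∑ x ∈ P.2, w x = n}

section
variable {ι : Type*} {w : ι → ℕ}

theorem weightedPairs_empty (w : ι → ℕ) (n : ℕ) :
    weightedPairs w ∅ ∅ n = if n = 0 then {(0, ∅)} else ∅ := by
  ext ⟨m, t⟩
  simp only [weightedPairs, Finset.notMem_empty, imp_false, ← Multiset.eq_zero_iff_forall_notMem,
    ← Finset.eq_empty_iff_forall_notMem, Set.mem_ofPred_eq]
  split_ifs with h
  · subst h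
    simp only [Set.mem_singleton_iff, Prod.mk.injEq]
    constructor
    · rintro ⟨rfl, rfl, -⟩
      simp
    · rintro ⟨rfl, rfl⟩
      simp
  · simp only [Set.mem_empty_iff_false, iff_false]
    rintro ⟨rfl, rfl, h'⟩
    exact h (by simpa using h'.symm)

variable [DecidableEq ι] {S T : Finset ι} {i : ι}

theorem weightedPairs_insert_left_of_lt {n : ℕ} (h : n < w i) :
    weightedPairs w (insert i S) T n = weightedPairs w S T n := by
  ext ⟨m, t⟩
  by_cases him : i ∈ m
  · obtain ⟨m, rfl⟩ := Multiset.exists_cons_of_mem him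
    simp [weightedPairs]
    grind
  · simp [weightedPairs]
    grind

theorem weightedPairs_insert_left_add (hi : i ∉ S) (n : ℕ) :
    weightedPairs w (insert i S) T (n + w i) = weightedPairs w S T (n + w i) ∪
        (fun P => (i ::ₘ P.1, P.2)) '' weightedPairs w (insert i S) T n := by
  ext ⟨m, t⟩
  by_cases him : i ∈ m
  · obtain ⟨m, rfl⟩ := Multiset.exists_cons_of_mem him
    simp [weightedPairs]
    grind
  · simp [weightedPairs]
    grind

theorem weightedPairs_insert_right_of_lt {n : ℕ} (h : n < w i) :
    weightedPairs w S (insert i T) n = weightedPairs w S T n := by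
  ext ⟨m, t⟩
  by_cases hit : i ∈ t
  · have := Finset.single_le_sum (f := w) (fun _ _ => Nat.zero_le _) hit
    simp [weightedPairs]
    grind
  · simp [weightedPairs]
    grind

theorem weightedPairs_insert_right_add (hi : i ∉ T) (n : ℕ) :
    weightedPairs w S (insert i T) (n + w i) = weightedPairs w S T (n + w i) ∪
        (fun P => (P.1, insert i P.2)) '' weightedPairs w S T n := by
  ext ⟨m, t⟩
  by_cases hit : i ∈ t
  · obtain ⟨u, hu, rfl⟩ : ∃ u, i ∉ u ∧ insert i u = t :=
      ⟨t.erase i, Finset.notMem_erase i t, Finset.insert_erase hit⟩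
    simp only [weightedPairs, Set.mem_union, Set.mem_image, Set.mem_ofPred_eq, Prod.exists,
      Prod.mk.injEq, Finset.sum_insert hu]
    constructor
    · rintro ⟨h1, h2, h3⟩
      refine Or.inr ⟨m, u, ⟨h1, fun x hx => ?_, by omega⟩, rfl, rfl⟩
      exact (Finset.mem_insert.mp (h2 x (Finset.mem_insert_of_mem hx))).resolve_left
        fun h => hu (h ▸ hx)
    · rintro (h | ⟨m', u', ⟨h1, h2, h3⟩, rfl, h⟩)
      · grind
      · have : u' = u := by
          rw [← Finset.erase_insert hu, ← h, Finset.erase_insert fun h' => hi (h2 i h')]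
        grind
  · simp [weightedPairs]
    grind

theorem weightedPairs_finite (hw : ∀ i, i ∈ S → 0 < w i) (n : ℕ) :
    (weightedPairs w S T n).Finite := by
  induction T using Finset.induction_on generalizing n with
  | empty =>
    induction S using Finset.induction_on generalizing n with
    | empty => rw [weightedPairs_empty]; split_ifs <;> simp
    | insert i S hi ih =>
      have ih := ih fun j hj => hw j (Finset.mem_insert_of_mem hj)
      induction n using Nat.strong_induction_on with
      | _ n ihn =>
        obtain h | h := lt_or_ge n (w i)
        · rw [weightedPairs_insert_left_of_lt h]
          exact ih n
        · obtain ⟨n, rfl⟩ := Nat.exists_eq_add_of_le' h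
          rw [weightedPairs_insert_left_add hi]
          have := hw i (Finset.mem_insert_self i S)
          exact (ih _).union ((ihn n (by omega)).image _)
  | insert i T hi ih =>
    obtain h | h := lt_or_ge n (w i)
    · rw [weightedPairs_insert_right_of_lt h]
      exact ih n
    · obtain ⟨n, rfl⟩ := Nat.exists_eq_add_of_le' h
      rw [weightedPairs_insert_right_add hi]
      exact (ih _).union ((ih n).image _)

theorem ncard_weightedPairs_insert_left (hw : ∀ j, j ∈ insert i S → 0 < w j) (hi : i ∉ S)
    (n : ℕ) :
    (weightedPairs w (insert i S) T (n + w i)).ncard =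
      (weightedPairs w S T (n + w i)).ncard + (weightedPairs w (insert i S) T n).ncard := by
  rw [weightedPairs_insert_left_add hi, Set.ncard_union_eq ?_ ?_ ?_, Set.ncard_image_of_injective]
  · rintro ⟨m, t⟩ ⟨m', t'⟩ h
    simpa using h
  · rw [Set.disjoint_right]
    rintro _ ⟨P, -, rfl⟩ h
    exact hi (h.1 i (Multiset.mem_cons_self i _))
  · exact weightedPairs_finite (fun j hj => hw j (Finset.mem_insert_of_mem hj)) _
  · exact (weightedPairs_finite hw n).image _

theorem ncard_weightedPairs_insert_right (hw : ∀ j, j ∈ S → 0 < w j) (hi : i ∉ T) (n : ℕ) :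
    (weightedPairs w S (insert i T) (n + w i)).ncard =
      (weightedPairs w S T (n + w i)).ncard + (weightedPairs w S T n).ncard := by
  rw [weightedPairs_insert_right_add hi, Set.ncard_union_eq ?_ ?_ ?_, Set.InjOn.ncard_image]
  · rintro ⟨m, t⟩ ⟨-, h1, -⟩ ⟨m', t'⟩ ⟨-, h2, -⟩ h
    have h1 : i ∉ t := fun h => hi (h1 i h)
    have h2 : i ∉ t' := fun h => hi (h2 i h)
    simp only [Prod.mk.injEq] at h ⊢
    exact ⟨h.1, by rw [← Finset.erase_insert h1, h.2, Finset.erase_insert h2]⟩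
  · rw [Set.disjoint_right]
    rintro _ ⟨P, -, rfl⟩ h
    exact hi (h.2.1 i (Finset.mem_insert_self i _))
  · exact weightedPairs_finite hw _
  · exact (weightedPairs_finite hw n).image _

/-- The generating function of the number of weighted pairs. -/
noncomputable def weightedPairsSeries (R : Type*) [CommRing R] (w : ι → ℕ) (S T : Finset ι) :
    R⟦X⟧ :=
  PowerSeries.mk fun n => ((weightedPairs w S T n).ncard : R)

variable {R : Type*} [CommRing R]

theorem weightedPairsSeries_insert_left (hw : ∀ j, j ∈ insert i S → 0 < w j) (hi : i ∉ S) :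
    (1 - X ^ w i) * weightedPairsSeries R w (insert i S) T = weightedPairsSeries R w S T := by
  ext n
  rw [sub_mul, one_mul, map_sub, coeff_X_pow_mul']
  simp only [weightedPairsSeries, coeff_mk]
  split_ifs with h
  · obtain ⟨n, rfl⟩ := Nat.exists_eq_add_of_le' h
    rw [ncard_weightedPairs_insert_left hw hi]
    simp
  · rw [weightedPairs_insert_left_of_lt (not_le.mp h), sub_zero]

theorem weightedPairsSeries_insert_right (hw : ∀ j, j ∈ S → 0 < w j) (hi : i ∉ T) :
    weightedPairsSeries R w S (insert i T) = (1 + X ^ w i) * weightedPairsSeries R w S T := by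
  ext n
  rw [add_mul, one_mul, map_add, coeff_X_pow_mul']
  simp only [weightedPairsSeries, coeff_mk]
  split_ifs with h
  · obtain ⟨n, rfl⟩ := Nat.exists_eq_add_of_le' h
    rw [ncard_weightedPairs_insert_right hw hi]
    simp
  · rw [weightedPairs_insert_right_of_lt (not_le.mp h), add_zero]

theorem prod_mul_weightedPairsSeries (hw : ∀ j, j ∈ S → 0 < w j) :
    (∏ j ∈ S, (1 - X ^ w j)) * weightedPairsSeries R w S T = ∏ j ∈ T, (1 + X ^ w j) := by
  induction T using Finset.induction_on with
  | empty =>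
    induction S using Finset.induction_on with
    | empty =>
      ext n
      simp only [weightedPairsSeries, weightedPairs_empty, Finset.prod_empty, one_mul, coeff_mk,
        coeff_one]
      split_ifs <;> simp
    | insert i S hi ih =>
      rw [Finset.prod_insert hi, mul_comm (1 - X ^ w i), mul_assoc,
        weightedPairsSeries_insert_left hw hi, ih fun j hj => hw j (Finset.mem_insert_of_mem hj)]
  | insert i T hi ih =>
    rw [weightedPairsSeries_insert_right hw hi, Finset.prod_insert hi, ← ih]
    ring

end

theorem overcubicSet_eq_weightedPairs {c n : ℕ} (hc : 1 ≤ c) :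
    overcubicSet c n =
      weightedPairs Prod.fst
        ((Finset.Icc 1 n ×ˢ Finset.range c).filter fun x => Even x.1 ∨ x.2 = 0)
        ((Finset.Icc 1 n ×ˢ Finset.range c).filter fun x => Even x.1 ∨ x.2 = 0) n := by
  have key : ∀ x : ℕ × ℕ, x.1 ≤ n → ((0 < x.1 ∧ (if Even x.1 then x.2 < c else x.2 = 0)) ↔
      x ∈ (Finset.Icc 1 n ×ˢ Finset.range c).filter fun x => Even x.1 ∨ x.2 = 0) := by
    intro x hx
    simp only [Finset.mem_filter, Finset.mem_product, Finset.mem_Icc, Finset.mem_range]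
    split_ifs with h
    · simp only [h, true_or, and_true]
      omega
    · simp only [h, false_or]
      omega
  ext ⟨m, t⟩
  have hm : (m.map Prod.fst).sum + ∑ x ∈ t, x.1 = n → ∀ x ∈ m, x.1 ≤ n := fun h x hx => by
    have := Multiset.single_le_sum (fun _ _ => Nat.zero_le _) _
      (Multiset.mem_map_of_mem Prod.fst hx)
    omega
  have ht : (m.map Prod.fst).sum + ∑ x ∈ t, x.1 = n → ∀ x ∈ t, x.1 ≤ n := fun h x hx => by
    have := Finset.single_le_sum (f := Prod.fst) (fun _ _ => Nat.zero_le _) hx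
    omega
  simp only [overcubicSet, weightedPairs, Set.mem_ofPred_eq]
  constructor
  · rintro ⟨h1, h2, h⟩
    exact ⟨fun x hx => (key x (hm h x hx)).1 (h1 x hx),
      fun x hx => (key x (ht h x hx)).1 (h2 x hx), h⟩
  · rintro ⟨h1, h2, h⟩
    exact ⟨fun x hx => (key x (hm h x hx)).2 (h1 x hx),
      fun x hx => (key x (ht h x hx)).2 (h2 x hx), h⟩

theorem prod_coloredParts_s13 {M : Type*} [CommMonoid M] {c : ℕ} (hc : 1 ≤ c) (n : ℕ) (f : ℕ → M) :
    ∏ x ∈ (Finset.Icc 1 n ×ˢ Finset.range c).filter (fun x => Even x.1 ∨ x.2 = 0), f x.1 =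
      ∏ i ∈ Finset.Icc 1 n, f i ^ (if Even i then c else 1) := by
  rw [Finset.prod_filter, Finset.prod_product]
  refine Finset.prod_congr rfl fun i _ => ?_
  split_ifs with h
  · simp [h]
  · simp [h, Nat.pos_iff_ne_zero.mp hc]

theorem prod_mul_weightedPairsSeries_coloredParts {R : Type*} [CommRing R] {c : ℕ} (hc : 1 ≤ c)
    (n : ℕ) : ∃ G : R⟦X⟧, coeff n G = (abar c n : R) ∧
      (∏ i ∈ Finset.Icc 1 n, (1 - X ^ i) ^ (if Even i then c else 1)) * G =
        ∏ i ∈ Finset.Icc 1 n, (1 + X ^ i) ^ (if Even i then c else 1) := by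
  let S := (Finset.Icc 1 n ×ˢ Finset.range c).filter fun x => Even x.1 ∨ x.2 = 0
  refine ⟨weightedPairsSeries R Prod.fst S S, ?_, ?_⟩
  · rw [weightedPairsSeries, coeff_mk, abar, overcubicSet_eq_weightedPairs hc]
  · rw [← prod_coloredParts_s13 hc, ← prod_coloredParts_s13 hc]
    refine prod_mul_weightedPairsSeries (w := Prod.fst) fun x hx => ?_
    simp only [Finset.mem_filter, Finset.mem_product, Finset.mem_Icc] at hx
    exact hx.1.1.1

theorem abar_eq_coeff {K : Type*} [Field K] (p k : ℕ) (hkp : 1 < k * p) (n : ℕ) :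
    ∃ E : K⟦X⟧, (abar (k * p - 1) n : K) = coeff n (E ^ p *
      ∏ i ∈ Finset.Icc 1 n, (1 - (-X) ^ i) * (1 + (-X) ^ i)⁻¹) := by
  obtain ⟨c, hc⟩ : ∃ c, k * p = c + 1 := ⟨k * p - 1, by omega⟩
  obtain ⟨G, hG, hGprod⟩ :=
    prod_mul_weightedPairsSeries_coloredParts (R := K) (c := k * p - 1) (by omega) n
  refine ⟨∏ i ∈ Finset.Icc 1 n, if Even i then ((1 + X ^ i) * (1 - X ^ i)⁻¹) ^ k else 1, ?_⟩
  rw [← hG, ← Finset.prod_pow, ← Finset.prod_mul_distrib]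
  congr 1
  have hne : ∀ i ∈ Finset.Icc 1 n, (1 - X ^ i : K⟦X⟧) ≠ 0 ∧ (1 - X ^ i : K⟦X⟧) * (1 - X ^ i)⁻¹ = 1 ∧
      (1 + X ^ i : K⟦X⟧) * (1 + X ^ i)⁻¹ = 1 := by
    intro i hi
    have hi : i ≠ 0 := by have := (Finset.mem_Icc.mp hi).1; omega
    have h1 : constantCoeff (1 - X ^ i : K⟦X⟧) ≠ 0 := by simp [hi]
    have h2 : constantCoeff (1 + X ^ i : K⟦X⟧) ≠ 0 := by simp [hi]
    exact ⟨fun h => h1 (by rw [h, map_zero]), PowerSeries.mul_inv_cancel _ h1,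
      PowerSeries.mul_inv_cancel _ h2⟩
  refine mul_left_cancel₀ (Finset.prod_ne_zero_iff.mpr
    fun i hi => pow_ne_zero (if Even i then k * p - 1 else 1) (hne i hi).1) ?_
  rw [hGprod, ← Finset.prod_mul_distrib]
  refine Finset.prod_congr rfl fun i hi => ?_
  obtain ⟨-, h1, h2⟩ := hne i hi
  generalize hu : (1 - X ^ i : K⟦X⟧)⁻¹ = u at *
  generalize hv : (1 + X ^ i : K⟦X⟧)⁻¹ = v at *
  by_cases h : Even i
  · simp only [h, if_true, h.neg_pow, hv]
    rw [← pow_mul, hc, Nat.add_sub_cancel]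
    generalize (1 - X ^ i : K⟦X⟧) = x at *
    generalize (1 + X ^ i : K⟦X⟧) = y at *
    calc y ^ c = (x * u) ^ (c + 1) * y ^ c * (y * v) := by rw [h1, h2]; simp
      _ = _ := by ring
  · simp only [h, if_false, (Nat.not_even_iff_odd.mp h).neg_pow, sub_neg_eq_add,
      ← sub_eq_add_neg, hu, one_pow, pow_one]
    linear_combination -(1 + X ^ i) * h1

theorem exists_prod_eq_partial_theta {K : Type*} [Field K] (n : ℕ) :
    ∃ F : K⟦X⟧, ∏ i ∈ Finset.Icc 1 n, (1 - (-X : K⟦X⟧) ^ i) * (1 + (-X) ^ i)⁻¹ =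
      1 + 2 * ∑ j ∈ Finset.range n, X ^ ((j + 1) ^ 2) + X ^ (n + 1) * F := by
  have hplus : ∀ i, constantCoeff (1 + (-X : K⟦X⟧) ^ (i + 1)) ≠ 0 := by simp
  have hminus : ∀ i, constantCoeff (1 - (-X : K⟦X⟧) ^ (i + 1)) ≠ 0 := by simp
  let P : ℕ → K⟦X⟧ := fun n => ∏ i ∈ Finset.Icc 1 n, (1 - (-X : K⟦X⟧) ^ i) * (1 + (-X) ^ i)⁻¹
  let a : ℕ → K⟦X⟧ := fun n =>
    Nat.rec 1 (fun s b => -(b * (1 + (-X) ^ s)) * (1 - (-X) ^ (s + 1))⁻¹) n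
  have h := gauss_partial (q := (-X : K⟦X⟧)) (P := P) (a := a)
    (fun i h => hplus i (by rw [h, map_zero])) (by simp [P]) rfl
    (fun i => by
      simp only [P]
      rw [Finset.prod_Icc_succ_top (by omega), mul_assoc, mul_assoc,
        PowerSeries.inv_mul_cancel _ (hplus i), mul_one])
    (fun i => by
      change -(a i * (1 + (-X) ^ i)) * (1 - (-X) ^ (i + 1))⁻¹ * _ = _
      rw [mul_assoc, PowerSeries.inv_mul_cancel _ (hminus i), mul_one]) n
  have hsq : ∀ j : ℕ, (-1 : K⟦X⟧) ^ (j + 1) * (-X) ^ ((j + 1) ^ 2) = X ^ ((j + 1) ^ 2) := by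
    intro j
    rw [neg_pow X, ← mul_assoc, ← pow_add, Even.neg_one_pow, one_mul]
    rw [sq, ← mul_one_add, add_comm 1]
    exact Nat.even_mul_succ_self (j + 1)
  simp only [hsq] at h
  rw [← h, Finset.sum_range_succ']
  refine ⟨-(P n * ∑ s ∈ Finset.range n, a (s + 1) * ((-1) ^ ((s + 1) * (n + 1)) *
    X ^ (s * (n + 1)))), ?_⟩
  have : ∀ s, a (s + 1) * (-X) ^ ((s + 1) * (n + 1)) = X ^ (n + 1) *
      (a (s + 1) * ((-1) ^ ((s + 1) * (n + 1)) * X ^ (s * (n + 1)))) := fun s => by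
    rw [neg_pow X]
    ring
  simp only [this, ← Finset.mul_sum]
  change P n = P n * (_ + 1 * _) + _
  ring

end

/-- For a prime `p ≥ 3`, `1 ≤ r ≤ p-1` a quadratic nonresidue mod `p`, and `k ≥ 1`,
`ā_{kp-1}(pn+r) ≡ 0 (mod p)` for all `n ≥ 0`. -/
theorem abar_kp_pred_cong (p : ℕ) (hp : p.Prime) (hp3 : 3 ≤ p) (r : ℕ)
    (hr1 : 1 ≤ r) (hr2 : r ≤ p - 1) (hnr : ¬ IsSquare ((r : ZMod p)))
    (k : ℕ) (hk : 1 ≤ k) (n : ℕ) :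
    p ∣ abar (k * p - 1) (p * n + r) := by
  have : Fact p.Prime := ⟨hp⟩
  have hkp : 1 < k * p := by nlinarith
  obtain ⟨E, hE⟩ := abar_eq_coeff (K := ZMod p) p k hkp (p * n + r)
  obtain ⟨F, hF⟩ := exists_prod_eq_partial_theta (K := ZMod p) (p * n + r)
  rw [← CharP.cast_eq_zero_iff (ZMod p), hE, hF]
  have hnot : ∀ d j : ℕ, p * n + r = d + j ^ 2 → ¬ p ∣ d := by
    rintro _ j h ⟨e, rfl⟩
    refine hnr ⟨j, ?_⟩
    have h := congrArg (Nat.cast (R := ZMod p)) h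
    push_cast at h
    rw [CharP.cast_eq_zero, zero_mul, zero_mul, zero_add, zero_add] at h
    rw [h, sq]
  have h1 : PowerSeries.coeff (p * n + r) (E ^ p) = 0 := coeff_pow_char p E (hnot _ 0 (by simp))
  have h2 : ∀ j, PowerSeries.coeff (p * n + r) (PowerSeries.X ^ ((j + 1) ^ 2) * E ^ p) = 0 := by
    intro j
    rw [PowerSeries.coeff_X_pow_mul']
    split_ifs with h
    · exact coeff_pow_char p E (hnot _ (j + 1) (by omega))
    · rfl
  have h3 : PowerSeries.coeff (p * n + r) (PowerSeries.X ^ (p * n + r + 1) * (F * E ^ p)) = 0 := by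
    rw [PowerSeries.coeff_X_pow_mul', if_neg (by omega)]
  have h4 : E ^ p * (1 + 2 * ∑ j ∈ Finset.range (p * n + r), PowerSeries.X ^ ((j + 1) ^ 2) +
      PowerSeries.X ^ (p * n + r + 1) * F) = E ^ p +
      (∑ j ∈ Finset.range (p * n + r), PowerSeries.X ^ ((j + 1) ^ 2) * E ^ p +
        ∑ j ∈ Finset.range (p * n + r), PowerSeries.X ^ ((j + 1) ^ 2) * E ^ p) +
      PowerSeries.X ^ (p * n + r + 1) * (F * E ^ p) := by
    rw [← Finset.sum_mul]
    ring
  rw [h4]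
  simp [h1, h2, h3]
end
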